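/- arXiv:2209.03675 — 2 statements merged into one kernel-verified Lean document; each statement's English description precedes it below -/
import Mathlib

section
/- For every odd positive integer k and every constant c > 0 there is a constant C(k,c) > 0 such that for every n, every positive integer f with f ≤ c·n^{2/(k(k+1))}, and every weighted graph G on n vertices, there exists an f-EFT (2k−1)-emulator H of G with |E(H)| ≤ C(k,c)·n^{1+1/k}. -/
open SimpleGraph
open scoped ENNReal

noncomputable section

/-- Weighted distance in a graph: the infimum, over all walks from `u` to `v`,
of the total weight of the walk's edges (`⊤` if there is no walk). -/
def wdist {V : Type} (G : SimpleGraph V) (w : Sym2 V → ℝ≥0∞) (u v : V) : ℝ≥0∞ :=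
  ⨅ p : G.Walk u v, (p.edges.map w).sum

/-- Distance in a graph `H` whose edge `(x, y)` is (re)weighted to `δ x y`. -/
def emulDist {V : Type} (H : SimpleGraph V) (δ : V → V → ℝ≥0∞) (u v : V) : ℝ≥0∞ :=
  ⨅ p : H.Walk u v, (p.darts.map (fun d => δ d.toProd.1 d.toProd.2)).sum

/-- `H` is an `f`-edge-fault-tolerant `t`-emulator of the weighted graph `(G, w)`:
for every fault set `F ⊆ E(G)` with `|F| ≤ f`, the graph `H` with every edge `(x,y)`
reweighted to `dist_{G∖F}(x,y)` approximates all distances of `G ∖ F` within factor `t`. -/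
def IsEFTEmulator {V : Type} (G : SimpleGraph V) (w : Sym2 V → ℝ≥0∞)
    (H : SimpleGraph V) (f : ℕ) (t : ℝ≥0∞) : Prop :=
  ∀ F : Finset (Sym2 V), ↑F ⊆ G.edgeSet → F.card ≤ f →
    ∀ u v : V,
      wdist (G.deleteEdges ↑F) w u v ≤ emulDist H (wdist (G.deleteEdges ↑F) w) u v ∧
      emulDist H (wdist (G.deleteEdges ↑F) w) u v ≤ t * wdist (G.deleteEdges ↑F) w u v

/-- `e` is the last edge of the list `l` in the order given by the ranking `π`. -/
def IsLastEdge {V : Type} (π : Sym2 V → ℕ) (l : List (Sym2 V)) (e : Sym2 V) : Prop :=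
  e ∈ l ∧ ∀ e' ∈ l, π e' ≤ π e

/-- The cycle `p` is blocked by the unordered pair `b` of edges: both members of `b`
lie on `p` and one of them is the last edge of `p` in the order `π`. -/
def CycleBlockedBy {V : Type} {H : SimpleGraph V} (π : Sym2 V → ℕ) {u : V}
    (p : H.Walk u u) (b : Sym2 (Sym2 V)) : Prop :=
  ∃ e1 e2 : Sym2 V, b = s(e1, e2) ∧ e1 ∈ p.edges ∧ e2 ∈ p.edges ∧ IsLastEdge π p.edges e1

/-- `B` is a `2k` double-blocking set for `H` with edge order `π`: it consists of
unordered pairs of distinct edges of `H`, every cycle with at most `2k` edges is blocked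
by a member of `B`, and every cycle with at most `k+1` edges is blocked by two
distinct members of `B`. -/
def IsDoubleBlockingSet {V : Type} (H : SimpleGraph V) (π : Sym2 V → ℕ) (k : ℕ)
    (B : Finset (Sym2 (Sym2 V))) : Prop :=
  (∀ b ∈ B, ¬ b.IsDiag ∧ ∀ e ∈ b, e ∈ H.edgeSet) ∧
  (∀ (u : V) (p : H.Walk u u), p.IsCycle → p.length ≤ 2 * k →
      ∃ b ∈ B, CycleBlockedBy π p b) ∧
  (∀ (u : V) (p : H.Walk u u), p.IsCycle → p.length ≤ k + 1 →
      ∃ b1 ∈ B, ∃ b2 ∈ B, b1 ≠ b2 ∧ CycleBlockedBy π p b1 ∧ CycleBlockedBy π p b2)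

/-- The number of pairs of `B` containing the edge `e`. -/
def edgeBlockCount {V : Type} (B : Finset (Sym2 (Sym2 V))) (e : Sym2 V) : ℕ :=
  {b ∈ (B : Set (Sym2 (Sym2 V))) | e ∈ b}.ncard

/-- The `i`-th edge of the vertex sequence `v`. -/
def edgeOf {V : Type} {k : ℕ} (v : Fin (k + 1) → V) (i : Fin k) : Sym2 V :=
  s(v i.castSucc, v i.succ)

/-- The average degree `2|E(H)|/n` of a graph on `n` vertices. -/
def avgDeg {V : Type} [Fintype V] (H : SimpleGraph V) : ℝ :=
  2 * (H.edgeSet.ncard : ℝ) / (Fintype.card V : ℝ)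

end
noncomputable section

/-- `v` is a SCUM `k`-path (for odd `k`), viewed as an oriented sequence of `k+1`
distinct pairwise-adjacent vertices: it is simple, its middle edge (the edge with
0-indexed position `(k-1)/2`, i.e. the index `j` with `2j+1 = k`) is the last edge
of the path in the order `π`, and the two oriented subpaths starting from the middle
edge and going towards either endpoint are chain-unblocked with respect to `B`. -/
def IsSCUM {V : Type} (H : SimpleGraph V) (π : Sym2 V → ℕ) (B : Finset (Sym2 (Sym2 V)))
    (k : ℕ) (v : Fin (k + 1) → V) : Prop :=
  Function.Injective v ∧
  (∀ i : Fin k, H.Adj (v i.castSucc) (v i.succ)) ∧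
  (∀ i j : Fin k, 2 * (j : ℕ) + 1 = k → π (edgeOf v i) ≤ π (edgeOf v j)) ∧
  (∀ (i : Fin k) (j : Fin (k + 1)), 2 * (i : ℕ) + 1 ≤ k → (j : ℕ) + 1 ≤ (i : ℕ) →
      ∀ e' : Sym2 V, s(edgeOf v i, e') ∈ B → v j ∉ e') ∧
  (∀ (i : Fin k) (j : Fin (k + 1)), k ≤ 2 * (i : ℕ) + 1 → (i : ℕ) + 2 ≤ (j : ℕ) →
      ∀ e' : Sym2 V, s(edgeOf v i, e') ∈ B → v j ∉ e')

/-- The number of (oriented) SCUM `k`-paths of `H`. -/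
def scumCount {V : Type} (H : SimpleGraph V) (π : Sym2 V → ℕ)
    (B : Finset (Sym2 (Sym2 V))) (k : ℕ) : ℕ :=
  {v : Fin (k + 1) → V | IsSCUM H π B k v}.ncard

/-- The number of (oriented, aligned) SCUM `k`-path meets of `H`: pairs of distinct
SCUM `k`-paths sharing both endpoints. -/
def scumMeetCount {V : Type} (H : SimpleGraph V) (π : Sym2 V → ℕ)
    (B : Finset (Sym2 (Sym2 V))) (k : ℕ) : ℕ :=
  {vv : (Fin (k + 1) → V) × (Fin (k + 1) → V) |
    IsSCUM H π B k vv.1 ∧ IsSCUM H π B k vv.2 ∧ vv.1 ≠ vv.2 ∧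
    vv.1 0 = vv.2 0 ∧ vv.1 (Fin.last k) = vv.2 (Fin.last k)}.ncard

/-- The oriented path given by the vertex sequence `a` is chain-unblocked with
respect to `B`: for any edge `e` of the path and any vertex `x` strictly following
`e` along the path, no pair `{e, e'} ∈ B` has `e'` incident on `x`. -/
def ChainUnblockedSeq {V : Type} (B : Finset (Sym2 (Sym2 V))) {L : ℕ}
    (a : Fin (L + 1) → V) : Prop :=
  ∀ (i : Fin L) (j : Fin (L + 1)), (i : ℕ) + 2 ≤ (j : ℕ) →
    ∀ e' : Sym2 V, s(edgeOf a i, e') ∈ B → a j ∉ e'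

/-- The walk `p` is blocked: some pair of `B` has both its edges on `p`. -/
def PathBlocked {V : Type} {H : SimpleGraph V} (B : Finset (Sym2 (Sym2 V)))
    {u v : V} (p : H.Walk u v) : Prop :=
  ∃ b ∈ B, ∀ e ∈ b, e ∈ p.edges

/-- The walk `p` is double-blocked: two distinct pairs of `B` have both their edges on `p`. -/
def PathDoubleBlocked {V : Type} {H : SimpleGraph V} (B : Finset (Sym2 (Sym2 V)))
    {u v : V} (p : H.Walk u v) : Prop :=
  ∃ b1 ∈ B, ∃ b2 ∈ B, b1 ≠ b2 ∧ (∀ e ∈ b1, e ∈ p.edges) ∧ (∀ e ∈ b2, e ∈ p.edges)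

/-- The subgraph of `H` consisting of the edge `e` together with all edges
preceding it in the order `π`. -/
def subEdges {V : Type} (H : SimpleGraph V) (π : Sym2 V → ℕ) (e : Sym2 V) : SimpleGraph V :=
  SimpleGraph.fromEdgeSet {e' ∈ H.edgeSet | π e' ≤ π e}

/-- `e` is a core edge of `H` (with respect to edge order `π` and degree threshold `d/4`):
`e` survives in the graph obtained from the subgraph of edges up to `e` by iteratively
deleting vertices of degree at most `d/4`; equivalently, there is a set `S` of vertices
containing both endpoints of `e` on which the subgraph of edges up to `e` induces
a graph of minimum degree greater than `d/4`. -/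
def IsCoreEdge {V : Type} (H : SimpleGraph V) (π : Sym2 V → ℕ) (d : ℝ) (e : Sym2 V) : Prop :=
  e ∈ H.edgeSet ∧
  ∃ S : Set V, (∀ x ∈ e, x ∈ S) ∧
    ∀ v ∈ S, d / 4 < ({u ∈ S | (subEdges H π e).Adj v u}.ncard : ℝ)

end

/-- Among the assignments in `S`, the values on `I` leave at most `N` possibilities for the
values on `J`. -/
def DetBound {ι V : Type} (S : Set (ι → V)) (I J : Set ι) (N : ℕ) : Prop :=
  ∀ ω₀ ∈ S, ∃ T : Finset (ι → V), T.card ≤ N ∧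
    ∀ ω ∈ S, Set.EqOn ω ω₀ I → ∃ τ ∈ T, Set.EqOn ω τ J

namespace DetBound

variable {ι κ V : Type} {S : Set (ι → V)} {I I' J J' K : Set ι} {N M : ℕ}

/-- The covering family may be chosen among the assignments being covered. -/
theorem exists_representatives (h : DetBound S I J N) {ω₀ : ι → V} (h₀ : ω₀ ∈ S) :
    ∃ T : Finset (ι → V), T.card ≤ N ∧ (∀ τ ∈ T, τ ∈ S ∧ Set.EqOn τ ω₀ I) ∧
      ∀ ω ∈ S, Set.EqOn ω ω₀ I → ∃ τ ∈ T, Set.EqOn ω τ J := by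
  classical
  obtain ⟨T, hT, hc⟩ := h ω₀ h₀
  let P : (ι → V) → (ι → V) → Prop := fun τ ω => ω ∈ S ∧ Set.EqOn ω ω₀ I ∧ Set.EqOn ω τ J
  let r : (ι → V) → (ι → V) := fun τ => if hx : ∃ ω, P τ ω then hx.choose else τ
  have hr : ∀ τ, (∃ ω, P τ ω) → P τ (r τ) := fun τ hx => by
    simp only [r, dif_pos hx]; exact hx.choose_spec
  refine ⟨(T.filter fun τ => ∃ ω, P τ ω).image r, ?_, ?_, ?_⟩
  · exact Finset.card_image_le.trans ((Finset.card_filter_le _ _).trans hT)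
  · intro τ hτ
    obtain ⟨τ', hτ', rfl⟩ := Finset.mem_image.1 hτ
    have := hr τ' (Finset.mem_filter.1 hτ').2
    exact ⟨this.1, this.2.1⟩
  · intro ω hω hI
    obtain ⟨τ, hτ, hJ⟩ := hc ω hω hI
    have hx : ∃ ω, P τ ω := ⟨ω, hω, hI, hJ⟩
    exact ⟨r τ, Finset.mem_image.2 ⟨τ, Finset.mem_filter.2 ⟨hτ, hx⟩, rfl⟩,
      hJ.trans (hr τ hx).2.2.symm⟩

theorem trans (h₁ : DetBound S I J N) (h₂ : DetBound S I' K M) (hI : I' ⊆ I ∪ J)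
    (hJ : J' ⊆ I ∪ J ∪ K) : DetBound S I J' (N * M) := by
  classical
  intro ω₀ h₀
  obtain ⟨T, hT, hTS, hc⟩ := h₁.exists_representatives h₀
  choose! U hU hUS hUc using fun τ (hτ : τ ∈ S) => h₂.exists_representatives hτ
  refine ⟨(T.biUnion fun τ => (U τ).image fun υ i => if i ∈ I ∪ J then τ i else υ i), ?_, ?_⟩
  · refine (Finset.card_biUnion_le_card_mul _ _ M fun τ hτ => ?_).trans
      (Nat.mul_le_mul_right _ hT)
    exact Finset.card_image_le.trans (hU τ (hTS τ hτ).1)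
  · intro ω hω hωI
    obtain ⟨τ, hτ, hωJ⟩ := hc ω hω hωI
    have hIJ : Set.EqOn ω τ (I ∪ J) := by
      rintro i (hi | hi)
      · rw [hωI hi, (hTS τ hτ).2 hi]
      · exact hωJ hi
    obtain ⟨υ, hυ, hωK⟩ := hUc τ (hTS τ hτ).1 ω hω fun i hi => hIJ (hI hi)
    refine ⟨_, Finset.mem_biUnion.2 ⟨τ, hτ, Finset.mem_image.2 ⟨υ, hυ, rfl⟩⟩, fun i hi => ?_⟩
    by_cases h : i ∈ I ∪ J
    · simp only [h, if_true]; exact hIJ h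
    · simp only [h, if_false]
      rcases hJ hi with h' | h'
      · exact absurd h' h
      · exact hωK h'

theorem mono (h : DetBound S I J N) (hI : I ⊆ I') (hJ : J' ⊆ I' ∪ J) (hN : N ≤ M) :
    DetBound S I' J' M := by
  classical
  intro ω₀ h₀
  obtain ⟨T, hT, hc⟩ := h ω₀ h₀
  refine ⟨T.image fun υ i => if i ∈ I' then ω₀ i else υ i,
    Finset.card_image_le.trans (hT.trans hN), fun ω hω hI' => ?_⟩
  obtain ⟨τ, hτ, hωJ⟩ := hc ω hω (hI'.mono hI)
  refine ⟨_, Finset.mem_image.2 ⟨τ, hτ, rfl⟩, fun i hi => ?_⟩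
  by_cases h : i ∈ I'
  · simp only [h, if_true]; exact hI' h
  · simp only [h, if_false]
    exact hωJ ((hJ hi).resolve_left h)

theorem mono_num (h : DetBound S I J N) (hN : N ≤ M) : DetBound S I J M :=
  h.mono subset_rfl Set.subset_union_right hN

/-- A bound for each fibre of the known values suffices. -/
theorem of_fibre (h : ∀ ω₀ ∈ S, DetBound {ω ∈ S | Set.EqOn ω ω₀ I} I J N) :
    DetBound S I J N := by
  intro ω₀ h₀
  obtain ⟨T, hT, hc⟩ := h ω₀ h₀ ω₀ ⟨h₀, fun _ _ => rfl⟩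
  exact ⟨T, hT, fun ω hω hI => hc ω ⟨hω, hI⟩ hI⟩

theorem biUnion {α : Type} (C : Finset α) (R : α → Set (ι → V))
    (hS : ∀ ω ∈ S, ∃ c ∈ C, ω ∈ R c)
    (h : ∀ c ∈ C, DetBound (S ∩ R c) I J N) : DetBound S I J (C.card * N) := by
  classical
  intro ω₀ h₀
  have : ∀ c ∈ C, ∃ T : Finset (ι → V), T.card ≤ N ∧
      ∀ ω ∈ S ∩ R c, Set.EqOn ω ω₀ I → ∃ τ ∈ T, Set.EqOn ω τ J := by
    intro c hc
    by_cases hx : ∃ ω ∈ S ∩ R c, Set.EqOn ω ω₀ I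
    · obtain ⟨ω₁, h₁, hI⟩ := hx
      obtain ⟨T, hT, hTc⟩ := h c hc ω₁ h₁
      exact ⟨T, hT, fun ω hω hωI => hTc ω hω (hωI.trans hI.symm)⟩
    · exact ⟨∅, by simp, fun ω hω hωI => absurd ⟨ω, hω, hωI⟩ hx⟩
  choose! T hT hc using this
  refine ⟨C.biUnion T, Finset.card_biUnion_le_card_mul _ _ _ hT, fun ω hω hI => ?_⟩
  obtain ⟨c, hcC, hcR⟩ := hS ω hω
  obtain ⟨τ, hτ, hJ⟩ := hc c hcC ω ⟨hω, hcR⟩ hI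
  exact ⟨τ, Finset.mem_biUnion.2 ⟨c, hcC, hτ⟩, hJ⟩

theorem comap {R : Set (κ → V)} {A B : Set κ} (h : DetBound R A B N) (σ : κ → ι)
    (hσ : ∀ ω ∈ S, ω ∘ σ ∈ R) : DetBound S (σ '' A) (σ '' B) N := by
  classical
  intro ω₀ h₀
  obtain ⟨T, hT, hc⟩ := h (ω₀ ∘ σ) (hσ ω₀ h₀)
  let P : (κ → V) → (ι → V) → Prop := fun τ ω => Set.EqOn (ω ∘ σ) τ B
  let r : (κ → V) → (ι → V) := fun τ => if hx : ∃ ω, P τ ω then hx.choose else ω₀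
  refine ⟨T.image r, Finset.card_image_le.trans hT, fun ω hω hI => ?_⟩
  obtain ⟨τ, hτ, hB⟩ := hc (ω ∘ σ) (hσ ω hω) fun a ha => hI ⟨a, ha, rfl⟩
  refine ⟨r τ, Finset.mem_image.2 ⟨τ, hτ, rfl⟩, ?_⟩
  have hx : ∃ ω, P τ ω := ⟨ω, hB⟩
  have hr : P τ (r τ) := by simp only [r, dif_pos hx]; exact hx.choose_spec
  rintro _ ⟨b, hb, rfl⟩
  exact (hB hb).trans (hr hb).symm

theorem of_subset (h : J ⊆ I) : DetBound S I J 1 :=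
  fun ω₀ _ => ⟨{ω₀}, by simp, fun ω _ hI => ⟨ω₀, by simp, hI.mono h⟩⟩

/-- One unknown value that lies in a set of size `N` determined by the known values. -/
theorem single [DecidableEq V] (i : ι) (A : (ι → V) → Finset V)
    (hA : ∀ ω ∈ S, (A ω).card ≤ N)
    (h : ∀ ω ∈ S, ∀ ω' ∈ S, Set.EqOn ω' ω I → ω' i ∈ A ω) : DetBound S I {i} N := by
  classical
  intro ω₀ h₀
  refine ⟨(A ω₀).image fun v => Function.update ω₀ i v,
    Finset.card_image_le.trans (hA ω₀ h₀), fun ω hω hI => ?_⟩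
  refine ⟨_, Finset.mem_image.2 ⟨ω i, h ω₀ h₀ ω hω hI, rfl⟩, ?_⟩
  rintro _ rfl
  simp

theorem card_le {α : Type} (A : Finset α) (g : α → ι → V) (hg : ∀ a ∈ A, g a ∈ S)
    (h : DetBound S ∅ J N) (hinj : ∀ a ∈ A, ∀ b ∈ A, Set.EqOn (g a) (g b) J → a = b) :
    A.card ≤ N := by
  classical
  rcases A.eq_empty_or_nonempty with rfl | ⟨a₀, ha₀⟩
  · simp
  obtain ⟨T, hT, hc⟩ := h (g a₀) (hg a₀ ha₀)
  have hex : ∀ a ∈ A, ∃ τ ∈ T, Set.EqOn (g a) τ J := fun a ha => hc _ (hg a ha) (by simp)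
  have : Nonempty (ι → V) := ⟨g a₀⟩
  choose! r hrT hr using hex
  refine (Finset.card_le_card_of_injOn r hrT fun a ha b hb hab => ?_).trans hT
  refine hinj a ha b hb ((hr a ha).trans ?_)
  rw [hab]
  exact (hr b hb).symm

end DetBound

/-- The edge between consecutive vertices `i` and `i + 1` of a vertex sequence. -/
def stepEdge {V : Type} (ω : ℕ → V) (i : ℕ) : Sym2 V := s(ω i, ω (i + 1))

/-- A graph of maximum degree at most `D` with ranked edges and a symmetric blocking relation on
edges, in which every edge is blocked with at most `f` others. In every closed walk of length at
most `2(2h+1)` without repeated edges, an edge of maximal rank is blocked with another edge of the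
walk, and with two other edges if the length is at most `2h+2`. -/
structure BlockedGraph (V : Type) (h f D : ℕ) where
  graph : SimpleGraph V
  nbrs : V → Finset V
  mem_nbrs : ∀ u v, v ∈ nbrs u ↔ graph.Adj u v
  card_nbrs : ∀ u, (nbrs u).card ≤ D
  rank : Sym2 V → ℕ
  bl : Sym2 V → Finset (Sym2 V)
  bl_symm : ∀ e e', e' ∈ bl e → e ∈ bl e'
  card_bl : ∀ e, (bl e).card ≤ f
  closed : ∀ (ω : ℕ → V) (L : ℕ), L ≤ 2 * (2 * h + 1) → ω L = ω 0 →
    (∀ i < L, graph.Adj (ω i) (ω (i + 1))) →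
    (∀ i < L, ∀ j < L, stepEdge ω i = stepEdge ω j → i = j) →
    ∀ a < L, (∀ i < L, rank (stepEdge ω i) ≤ rank (stepEdge ω a)) →
    ∃ b < L, b ≠ a ∧ stepEdge ω b ∈ bl (stepEdge ω a) ∧
      (L ≤ 2 * h + 2 → ∃ b' < L, b' ≠ a ∧ b' ≠ b ∧ stepEdge ω b' ∈ bl (stepEdge ω a))

namespace BlockedGraph

variable {V ι : Type} {h f D F : ℕ} (G : BlockedGraph V h f D)

/-- The first `m + 1` terms of `ω` form a simple path. -/
def IsPth (ω : ℕ → V) (m : ℕ) : Prop :=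
  (∀ i < m, G.graph.Adj (ω i) (ω (i + 1))) ∧ ∀ i ≤ m, ∀ j ≤ m, ω i = ω j → i = j

/-- A path without blocked pairs of edges. -/
def Unb (ω : ℕ → V) (m : ℕ) : Prop :=
  G.IsPth ω m ∧ ∀ i j, i < j → j < m → stepEdge ω j ∉ G.bl (stepEdge ω i)

/-- A path with at most one blocked pair of edges. -/
def One (ω : ℕ → V) (m : ℕ) : Prop :=
  G.IsPth ω m ∧ ∀ i j i' j', i < j → j < m → i' < j' → j' < m →
    stepEdge ω j ∈ G.bl (stepEdge ω i) → stepEdge ω j' ∈ G.bl (stepEdge ω i') → i = i' ∧ j = j'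

variable {G} {ω p q : ℕ → V} {m ℓ₁ ℓ₂ : ℕ}

theorem IsPth.stepEdge_inj (hp : G.IsPth ω m) {i j : ℕ} (hi : i < m) (hj : j < m)
    (he : stepEdge ω i = stepEdge ω j) : i = j := by
  simp only [stepEdge, Sym2.eq_iff] at he
  rcases he with ⟨h1, -⟩ | ⟨h1, h2⟩
  · exact hp.2 _ hi.le _ hj.le h1
  · have := hp.2 _ hi.le _ hj h1
    have := hp.2 _ hi _ hj.le h2
    omega

theorem IsPth.window (hp : G.IsPth ω m) {s m' : ℕ} (hs : s + m' ≤ m) :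
    G.IsPth (fun i => ω (s + i)) m' := by
  refine ⟨fun i hi => hp.1 (s + i) (by omega), fun i hi j hj he => ?_⟩
  have := hp.2 _ (by omega) _ (by omega) he
  omega

theorem Unb.window (hp : G.Unb ω m) {s m' : ℕ} (hs : s + m' ≤ m) :
    G.Unb (fun i => ω (s + i)) m' :=
  ⟨hp.1.window hs, fun i j hi hj => hp.2 (s + i) (s + j) (by omega) (by omega)⟩

theorem One.window (hp : G.One ω m) {s m' : ℕ} (hs : s + m' ≤ m) :
    G.One (fun i => ω (s + i)) m' := by
  refine ⟨hp.1.window hs, fun i j i' j' h1 h2 h3 h4 h5 h6 => ?_⟩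
  have := hp.2 (s + i) (s + j) (s + i') (s + j') (by omega) (by omega) (by omega) (by omega) h5 h6
  omega

theorem Unb.not_mem (hp : G.Unb ω m) {i j : ℕ} (hi : i < m) (hj : j < m) (hij : i ≠ j) :
    stepEdge ω j ∉ G.bl (stepEdge ω i) := by
  rcases Nat.lt_or_gt_of_ne hij with h1 | h1
  · exact hp.2 i j h1 hj
  · exact fun h2 => hp.2 j i h1 hi (G.bl_symm _ _ h2)

theorem exists_max_rank (r : Sym2 V → ℕ) (ω : ℕ → V) (hm : 0 < m) :
    ∃ a < m, ∀ i < m, r (stepEdge ω i) ≤ r (stepEdge ω a) := by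
  obtain ⟨a, ha, hmax⟩ := Finset.exists_max_image (Finset.range m) (fun i => r (stepEdge ω i))
    ⟨0, by simpa⟩
  exact ⟨a, by simpa using ha, fun i hi => hmax i (by simpa using hi)⟩

/-- Two edge-disjoint paths with the same endpoints close up to a walk to which the blocking
condition applies. -/
theorem two_paths (hp : G.IsPth p ℓ₁) (hq : G.IsPth q ℓ₂) (h0 : p 0 = q 0) (h1 : p ℓ₁ = q ℓ₂)
    (hdis : ∀ i < ℓ₁, ∀ j < ℓ₂, stepEdge p i ≠ stepEdge q j) (hL : ℓ₁ + ℓ₂ ≤ 2 * (2 * h + 1))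
    {a : ℕ} (ha : a < ℓ₁) (hmp : ∀ i < ℓ₁, G.rank (stepEdge p i) ≤ G.rank (stepEdge p a))
    (hmq : ∀ i < ℓ₂, G.rank (stepEdge q i) ≤ G.rank (stepEdge p a)) :
    ∃ e ∈ G.bl (stepEdge p a),
      ((∃ b < ℓ₁, b ≠ a ∧ stepEdge p b = e) ∨ ∃ b < ℓ₂, stepEdge q b = e) ∧
      (ℓ₁ + ℓ₂ ≤ 2 * h + 2 → ∃ e' ∈ G.bl (stepEdge p a), e' ≠ e ∧
        ((∃ b < ℓ₁, b ≠ a ∧ stepEdge p b = e') ∨ ∃ b < ℓ₂, stepEdge q b = e')) := by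
  set ω : ℕ → V := fun i => if i ≤ ℓ₁ then p i else q (ℓ₁ + ℓ₂ - i) with hω
  have e1 : ∀ i < ℓ₁, stepEdge ω i = stepEdge p i := by
    intro i hi
    simp only [stepEdge, hω, if_pos hi.le, if_pos (show i + 1 ≤ ℓ₁ from hi)]
  have e2 : ∀ i, ℓ₁ ≤ i → i < ℓ₁ + ℓ₂ → stepEdge ω i = stepEdge q (ℓ₁ + ℓ₂ - 1 - i) := by
    intro i hi hi'
    have hx : ω i = q (ℓ₁ + ℓ₂ - i) := by
      rcases hi.eq_or_lt with rfl | h2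
      · simp only [hω, le_refl, if_true, h1]; congr 1; omega
      · simp only [hω, if_neg (not_le.2 h2)]
    have hy : ω (i + 1) = q (ℓ₁ + ℓ₂ - (i + 1)) := by
      simp only [hω, if_neg (show ¬ i + 1 ≤ ℓ₁ by omega)]
    rw [stepEdge, stepEdge, hx, hy, Sym2.eq_swap,
      show ℓ₁ + ℓ₂ - (i + 1) = ℓ₁ + ℓ₂ - 1 - i by omega,
      show ℓ₁ + ℓ₂ - i = ℓ₁ + ℓ₂ - 1 - i + 1 by omega]
  have cov : ∀ b < ℓ₁ + ℓ₂, b ≠ a →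
      ((∃ b' < ℓ₁, b' ≠ a ∧ stepEdge p b' = stepEdge ω b) ∨
        ∃ b' < ℓ₂, stepEdge q b' = stepEdge ω b) := by
    intro b hb hba
    rcases lt_or_ge b ℓ₁ with h2 | h2
    · exact Or.inl ⟨b, h2, hba, (e1 b h2).symm⟩
    · exact Or.inr ⟨_, by omega, (e2 b h2 hb).symm⟩
  have hinj : ∀ i < ℓ₁ + ℓ₂, ∀ j < ℓ₁ + ℓ₂, stepEdge ω i = stepEdge ω j → i = j := by
    intro i hi j hj he
    rcases lt_or_ge i ℓ₁ with h2 | h2 <;> rcases lt_or_ge j ℓ₁ with h3 | h3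
    · rw [e1 i h2, e1 j h3] at he
      exact hp.stepEdge_inj h2 h3 he
    · rw [e1 i h2, e2 j h3 hj] at he
      exact absurd he (hdis _ h2 _ (by omega))
    · rw [e2 i h2 hi, e1 j h3] at he
      exact absurd he.symm (hdis _ h3 _ (by omega))
    · rw [e2 i h2 hi, e2 j h3 hj] at he
      have := hq.stepEdge_inj (by omega) (by omega) he
      omega
  have hadj : ∀ i < ℓ₁ + ℓ₂, G.graph.Adj (ω i) (ω (i + 1)) := by
    intro i hi
    rw [← SimpleGraph.mem_edgeSet]
    change stepEdge ω i ∈ _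
    rcases lt_or_ge i ℓ₁ with h2 | h2
    · rw [e1 i h2]; exact hp.1 i h2
    · rw [e2 i h2 hi]; exact hq.1 _ (by omega)
  have hcl : ω (ℓ₁ + ℓ₂) = ω 0 := by
    have hx : ω 0 = p 0 := by simp [hω]
    rw [hx]
    rcases Nat.eq_zero_or_pos ℓ₂ with rfl | h2
    · simp [hω, h1, h0]
    · simp [hω, h2.ne', h0]
  obtain ⟨b, hb, hba, hbl, hs⟩ := G.closed ω (ℓ₁ + ℓ₂) hL hcl hadj hinj a (by omega) (by
    intro i hi
    rw [e1 a ha]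
    rcases lt_or_ge i ℓ₁ with h2 | h2
    · rw [e1 i h2]; exact hmp i h2
    · rw [e2 i h2 hi]; exact hmq _ (by omega))
  rw [e1 a ha] at hbl hs
  refine ⟨_, hbl, cov b hb hba, fun hshort => ?_⟩
  obtain ⟨b', hb', hb'a, hb'b, hbl'⟩ := hs hshort
  exact ⟨_, hbl', fun he => hb'b (hinj _ hb' _ hb he), cov b' hb' hb'a⟩

theorem Unb.exists_blocked (hp : G.Unb p ℓ₁) (hq : G.IsPth q ℓ₂) (h0 : p 0 = q 0)
    (h1 : p ℓ₁ = q ℓ₂) (hdis : ∀ i < ℓ₁, ∀ j < ℓ₂, stepEdge p i ≠ stepEdge q j)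
    (hL : ℓ₁ + ℓ₂ ≤ 2 * (2 * h + 1))
    {a : ℕ} (ha : a < ℓ₁) (hmp : ∀ i < ℓ₁, G.rank (stepEdge p i) ≤ G.rank (stepEdge p a))
    (hmq : ∀ i < ℓ₂, G.rank (stepEdge q i) ≤ G.rank (stepEdge p a)) :
    ∃ b < ℓ₂, stepEdge q b ∈ G.bl (stepEdge p a) ∧
      (ℓ₁ + ℓ₂ ≤ 2 * h + 2 → ∃ b' < ℓ₂, b' ≠ b ∧ stepEdge q b' ∈ G.bl (stepEdge p a)) := by
  obtain ⟨e, he, hc, hs⟩ := two_paths hp.1 hq h0 h1 hdis hL ha hmp hmq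
  have key : ∀ e ∈ G.bl (stepEdge p a),
      ((∃ b < ℓ₁, b ≠ a ∧ stepEdge p b = e) ∨ ∃ b < ℓ₂, stepEdge q b = e) →
      ∃ b < ℓ₂, stepEdge q b = e := by
    rintro e he (⟨b, hb, hba, rfl⟩ | hx)
    · exact absurd he (hp.not_mem ha hb hba.symm)
    · exact hx
  obtain ⟨b, hb, rfl⟩ := key e he hc
  refine ⟨b, hb, he, fun hL => ?_⟩
  obtain ⟨e', he', hne, hc'⟩ := hs hL
  obtain ⟨b', hb', rfl⟩ := key e' he' hc'
  exact ⟨b', hb', fun hx => hne (by rw [hx]), he'⟩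

theorem Unb.cross (hp : G.Unb p m) (hq : G.Unb q m) (h0 : p 0 = q 0) (h1 : p m = q m)
    (hm : 0 < m) (hM : m ≤ 2 * h + 1) :
    ∃ i < m, ∃ j < m, stepEdge p i = stepEdge q j ∨ stepEdge p i ∈ G.bl (stepEdge q j) := by
  by_cases hd : ∀ i < m, ∀ j < m, stepEdge p i ≠ stepEdge q j
  · obtain ⟨a, ha, hmp⟩ := exists_max_rank G.rank p hm
    obtain ⟨b, hb, hmq⟩ := exists_max_rank G.rank q hm
    rcases le_total (G.rank (stepEdge q b)) (G.rank (stepEdge p a)) with hab | hab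
    · obtain ⟨c, hc, hbl, -⟩ := hp.exists_blocked hq.1 h0 h1 hd (by omega) ha hmp
        fun i hi => (hmq i hi).trans hab
      exact ⟨a, ha, c, hc, Or.inr (G.bl_symm _ _ hbl)⟩
    · obtain ⟨c, hc, hbl, -⟩ := hq.exists_blocked hp.1 h0.symm h1.symm
        (fun i hi j hj => (hd j hj i hi).symm) (by omega) hb hmq
        fun i hi => (hmp i hi).trans hab
      exact ⟨c, hc, b, hb, Or.inr hbl⟩
  · push Not at hd
    obtain ⟨i, hi, j, hj, he⟩ := hd
    exact ⟨i, hi, j, hj, Or.inl he⟩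

theorem One.exists_blocked (hp : G.One p m) (hq : G.IsPth q m) (h0 : p 0 = q 0)
    (h1 : p m = q m) (hdis : ∀ i < m, ∀ j < m, stepEdge p i ≠ stepEdge q j)
    (hM : m ≤ h + 1)
    {a : ℕ} (ha : a < m) (hmp : ∀ i < m, G.rank (stepEdge p i) ≤ G.rank (stepEdge p a))
    (hmq : ∀ i < m, G.rank (stepEdge q i) ≤ G.rank (stepEdge p a)) :
    ∃ b < m, stepEdge q b ∈ G.bl (stepEdge p a) := by
  obtain ⟨e, he, hc, hs⟩ := two_paths hp.1 hq h0 h1 hdis (by omega) ha hmp hmq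
  obtain ⟨e', he', hne, hc'⟩ := hs (by omega)
  rcases hc with ⟨b, hb, hba, rfl⟩ | ⟨b, hb, rfl⟩
  · rcases hc' with ⟨b', hb', hba', rfl⟩ | ⟨b', hb', rfl⟩
    · exfalso
      refine hne (congrArg _ ?_)
      rcases Nat.lt_or_gt_of_ne hba with h2 | h2 <;> rcases Nat.lt_or_gt_of_ne hba' with h3 | h3
      · exact (hp.2 b' a b a h3 ha h2 ha (G.bl_symm _ _ he') (G.bl_symm _ _ he)).1
      · have := hp.2 a b' b a h3 hb' h2 ha he' (G.bl_symm _ _ he); omega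
      · have := hp.2 b' a a b h3 ha h2 hb (G.bl_symm _ _ he') he; omega
      · exact (hp.2 a b' a b h3 hb' h2 hb he' he).2
    · exact ⟨b', hb', he'⟩
  · exact ⟨b, hb, he⟩

theorem One.cross (hp : G.One p m) (hq : G.One q m) (h0 : p 0 = q 0) (h1 : p m = q m)
    (hm : 0 < m) (hM : m ≤ h + 1) :
    ∃ i < m, ∃ j < m, stepEdge p i = stepEdge q j ∨ stepEdge p i ∈ G.bl (stepEdge q j) := by
  by_cases hd : ∀ i < m, ∀ j < m, stepEdge p i ≠ stepEdge q j
  · obtain ⟨a, ha, hmp⟩ := exists_max_rank G.rank p hm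
    obtain ⟨b, hb, hmq⟩ := exists_max_rank G.rank q hm
    rcases le_total (G.rank (stepEdge q b)) (G.rank (stepEdge p a)) with hab | hab
    · obtain ⟨c, hc, hbl⟩ := hp.exists_blocked hq.1 h0 h1 hd hM ha hmp
        fun i hi => (hmq i hi).trans hab
      exact ⟨a, ha, c, hc, Or.inr (G.bl_symm _ _ hbl)⟩
    · obtain ⟨c, hc, hbl⟩ := hq.exists_blocked hp.1 h0.symm h1.symm
        (fun i hi j hj => (hd j hj i hi).symm) hM hb hmq
        fun i hi => (hmp i hi).trans hab
      exact ⟨c, hc, b, hb, Or.inr hbl⟩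
  · push Not at hd
    obtain ⟨i, hi, j, hj, he⟩ := hd
    exact ⟨i, hi, j, hj, Or.inl he⟩

end BlockedGraph

namespace DetBound

variable {V ι : Type} {S : Set (ι → V)} {I : Set ι}

/-- A pair of unknown values spanning one of finitely many edges. -/
theorem of_edge (E : Finset (Sym2 V)) (x y : ι) (hE : ∀ ω ∈ S, s(ω x, ω y) ∈ E) :
    DetBound S I {x, y} (2 * E.card) := by
  classical
  intro ω₀ _
  let up : V → V → ι → V := fun a b i => if i = x then a else if i = y then b else ω₀ i
  refine ⟨E.biUnion fun e =>
      {up e.out.1 e.out.2, up e.out.2 e.out.1}, ?_, fun ω hω _ => ?_⟩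
  · rw [mul_comm]
    exact Finset.card_biUnion_le_card_mul _ _ _ fun e _ => Finset.card_le_two
  · have hup : Set.EqOn ω (up (ω x) (ω y)) {x, y} := by
      rintro i (rfl | rfl)
      · simp [up]
      · by_cases hx : i = x <;> simp [up, hx]
    refine ⟨up (ω x) (ω y), Finset.mem_biUnion.2 ⟨_, hE ω hω, ?_⟩, hup⟩
    set e := s(ω x, ω y) with he
    have : s(e.out.1, e.out.2) = s(ω x, ω y) := by
      rw [← he]; exact Quot.out_eq e
    rcases Sym2.eq_iff.1 this with ⟨h1, h2⟩ | ⟨h1, h2⟩ <;> simp [h1, h2]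

end DetBound

namespace BlockedGraph

variable {V ι : Type} {h f D F : ℕ} {G : BlockedGraph V h f D}

/-- Paths of length `m` from a family any two members of which, given that they have the same
endpoints, contain equal or blocked edges. -/
theorem window_bound (S : ℕ → Set (ℕ → V)) (M : ℕ)
    (hsub : ∀ m ω s m', ω ∈ S m → s + m' ≤ m → (fun i => ω (s + i)) ∈ S m')
    (hcross : ∀ m ≤ M, 0 < m → ∀ p ∈ S m, ∀ q ∈ S m, p 0 = q 0 → p m = q m →
      ∃ i < m, ∃ j < m, stepEdge p i = stepEdge q j ∨ stepEdge p i ∈ G.bl (stepEdge q j))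
    (hF : M * M * (2 * (f + 1)) ≤ F) (hF1 : 1 ≤ F) (m : ℕ) (hm : m ≤ M) :
    DetBound (S m) {0, m} (Set.Iic m) (F ^ (m - 1)) := by
  classical
  induction m using Nat.strong_induction_on with
  | _ m ih =>
  rcases Nat.lt_or_ge m 2 with h2 | h2
  · refine (DetBound.of_subset fun i hi => ?_).mono_num (Nat.one_le_pow _ _ hF1)
    have : i = 0 ∨ i = m := by have := Set.mem_Iic.1 hi; omega
    simpa using this
  refine DetBound.of_fibre fun ω₀ h₀ => ?_
  set S' := {ω ∈ S m | Set.EqOn ω ω₀ {0, m}} with hS'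
  refine (DetBound.biUnion (Finset.range m ×ˢ Finset.range m)
    (fun c => {ω | stepEdge ω c.1 = stepEdge ω₀ c.2 ∨ stepEdge ω c.1 ∈ G.bl (stepEdge ω₀ c.2)})
    (N := 2 * (f + 1) * F ^ (m - 2)) ?_ ?_).mono_num ?_
  · intro ω hω
    obtain ⟨i, hi, j, hj, hij⟩ := hcross m hm (by omega) ω hω.1 ω₀ h₀
      (hω.2 (by simp)) (hω.2 (by simp))
    exact ⟨(i, j), by simp [hi, hj], hij⟩
  · rintro ⟨i, j⟩ hij
    simp only [Finset.mem_product, Finset.mem_range] at hij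
    set R : Set (ℕ → V) :=
      {ω | stepEdge ω i = stepEdge ω₀ j ∨ stepEdge ω i ∈ G.bl (stepEdge ω₀ j)}
    have hSm : ∀ ω ∈ S' ∩ R, ω ∈ S m := fun ω hω => hω.1.1
    have b1 : DetBound (S' ∩ R) {0, m} {i, i + 1} (2 * (f + 1)) := by
      refine (DetBound.of_edge (insert (stepEdge ω₀ j) (G.bl (stepEdge ω₀ j))) i (i + 1)
        fun ω hω => ?_).mono_num ?_
      · exact Finset.mem_insert.2 hω.2
      · exact Nat.mul_le_mul_left _ ((Finset.card_insert_le _ _).trans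
          (Nat.add_le_add_right (G.card_bl _) _))
    have b2 := (ih i hij.1 (by omega)).comap (S := S' ∩ R) id fun ω hω => by
      simpa using hsub m ω 0 i (hSm ω hω) (by omega)
    have b3 := (ih (m - (i + 1)) (by omega) (by omega)).comap (S := S' ∩ R) (fun x => i + 1 + x)
      fun ω hω => hsub m ω (i + 1) (m - (i + 1)) (hSm ω hω) (by omega)
    have b4 := b1.trans (J' := {0, m} ∪ Set.Iic (i + 1)) b2 (by
        rintro x ⟨y, hy, rfl⟩
        simp only [Set.mem_insert_iff, Set.mem_singleton_iff, Set.mem_union, id] at hy ⊢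
        omega) (by
        intro x hx
        simp only [Set.mem_insert_iff, Set.mem_singleton_iff, Set.mem_union, Set.image_id,
          Set.mem_Iic] at hx ⊢
        omega)
    have b5 := b4.trans (J' := Set.Iic m) b3 (by
        rintro x ⟨y, hy, rfl⟩
        simp only [Set.mem_insert_iff, Set.mem_singleton_iff, Set.mem_union, Set.mem_Iic] at hy ⊢
        omega) (by
        intro x hx
        rw [Set.mem_Iic] at hx
        rcases Nat.lt_or_ge (i + 1) x with h3 | h3
        · exact Or.inr ⟨x - (i + 1), by simp only [Set.mem_Iic]; omega, by simp only; omega⟩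
        · exact Or.inl (Or.inr (Or.inr h3)))
    refine b5.mono_num ?_
    rw [mul_assoc, ← pow_add]
    exact Nat.mul_le_mul_left _ (Nat.pow_le_pow_right hF1 (by omega))
  · rw [Finset.card_product, Finset.card_range, ← mul_assoc,
      show m - 1 = m - 2 + 1 by omega, pow_succ, mul_comm (F ^ _)]
    exact Nat.mul_le_mul_right _ ((Nat.mul_le_mul_right _ (Nat.mul_le_mul hm hm)).trans hF)

theorem unb_bound (hF : (2 * h + 1) * (2 * h + 1) * (2 * (f + 1)) ≤ F) {m : ℕ}
    (hm : m ≤ 2 * h + 1) : DetBound {ω | G.Unb ω m} {0, m} (Set.Iic m) (F ^ (m - 1)) :=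
  window_bound (G := G) (fun m => {ω | G.Unb ω m}) (2 * h + 1)
    (fun _ _ _ _ hω hs => Unb.window hω hs)
    (fun _ hm h0 _ hp _ hq h1 h2 => Unb.cross hp hq h1 h2 h0 hm) hF
    (le_trans (by nlinarith) hF) m hm

theorem one_bound (hF : (2 * h + 1) * (2 * h + 1) * (2 * (f + 1)) ≤ F) {m : ℕ}
    (hm : m ≤ h + 1) : DetBound {ω | G.One ω m} {0, m} (Set.Iic m) (F ^ (m - 1)) :=
  window_bound (G := G) (fun m => {ω | G.One ω m}) (h + 1)
    (fun _ _ _ _ hω hs => One.window hω hs)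
    (fun _ hm h0 _ hp _ hq h1 h2 => One.cross hp hq h1 h2 h0 hm)
    (le_trans (Nat.mul_le_mul_right _ (Nat.mul_le_mul (by omega) (by omega))) hF)
    (le_trans (by nlinarith) hF) m hm

/-- Extending along a walk costs a factor `D` for every step. -/
theorem ext_bound {S : Set (ι → V)} (σ : ℕ → ι) (m : ℕ)
    (hS : ∀ ω ∈ S, ∀ i < m, G.graph.Adj (ω (σ i)) (ω (σ (i + 1)))) :
    DetBound S {σ 0} (σ '' Set.Iic m) (D ^ m) := by
  classical
  induction m with
  | zero =>
    refine DetBound.of_subset ?_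
    rintro _ ⟨x, hx, rfl⟩
    simp only [Set.mem_Iic, Nat.le_zero] at hx
    simp [hx]
  | succ m ih =>
    rw [pow_succ]
    refine (ih fun ω hω i hi => hS ω hω i (by omega)).trans
      (DetBound.single (I := {σ m}) (σ (m + 1)) (fun ω => G.nbrs (ω (σ m)))
        (fun ω _ => G.card_nbrs _) fun ω hω ω' hω' he => ?_) ?_ ?_
    · rw [← he rfl, G.mem_nbrs]
      exact hS ω' hω' m (by omega)
    · rintro _ rfl
      exact Or.inr ⟨m, by simp, rfl⟩
    · rintro _ ⟨x, hx, rfl⟩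
      rw [Set.mem_Iic] at hx
      rcases hx.lt_or_eq with h1 | rfl
      · exact Or.inl (Or.inr ⟨x, Set.mem_Iic.2 (by omega), rfl⟩)
      · exact Or.inr rfl

/-- An edge that is blocked with a known edge costs a factor `2f`. -/
theorem block_bound {S : Set (ι → V)} (x y x' y' : ι)
    (hS : ∀ ω ∈ S, s(ω x', ω y') ∈ G.bl s(ω x, ω y)) (hF : 2 * f ≤ F) :
    DetBound S {x, y} {x', y'} F := by
  refine DetBound.of_fibre fun ω₀ h₀ => ?_
  refine (DetBound.of_edge (G.bl s(ω₀ x, ω₀ y)) x' y' fun ω hω => ?_).mono_num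
    ((Nat.mul_le_mul_left _ (G.card_bl _)).trans hF)
  have := hS ω hω.1
  rwa [hω.2 (show x ∈ _ by simp), hω.2 (show y ∈ _ by simp)] at this

end BlockedGraph

theorem pow_mul_pow_le_of_le {D F a b a' b' : ℕ} (hF : 1 ≤ F) (hFD : F ≤ D) (h1 : a ≤ a')
    (h2 : a + b ≤ a' + b') : D ^ a * F ^ b ≤ D ^ a' * F ^ b' := by
  obtain ⟨c, rfl⟩ := Nat.exists_eq_add_of_le h1
  calc D ^ a * F ^ b ≤ D ^ a * F ^ (c + b') :=
        Nat.mul_le_mul_left _ (Nat.pow_le_pow_right hF (by omega))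
    _ = D ^ a * F ^ c * F ^ b' := by rw [pow_add, mul_assoc]
    _ ≤ D ^ a * D ^ c * F ^ b' := by gcongr
    _ = D ^ (a + c) * F ^ b' := by rw [pow_add]

namespace DetBound

variable {V ι : Type} {S : Set (ι → V)}

theorem of_eq {x y : ι} (hS : ∀ ω ∈ S, ω x = ω y) : DetBound S {x} {y} 1 := by
  classical
  refine DetBound.single y (fun ω => {ω x}) (by simp) fun ω _ ω' hω' he => ?_
  rw [Finset.mem_singleton, ← hS ω' hω', he rfl]

end DetBound

namespace BlockedGraph

variable {V ι : Type} {h f D F : ℕ} {G : BlockedGraph V h f D}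

/-- Two unblocked paths that start at a common vertex and are otherwise disjoint. -/
structure Fork (G : BlockedGraph V h f D) (P Q : ℕ → V) (A B : ℕ) : Prop where
  left : G.Unb P A
  right : G.Unb Q B
  base : P 0 = Q 0
  disj : ∀ i ≤ A, ∀ j ≤ B, P i = Q j → i = 0 ∧ j = 0

theorem Fork.swap {P Q : ℕ → V} {A B : ℕ} (hf : G.Fork P Q A B) : G.Fork Q P B A :=
  ⟨hf.right, hf.left, hf.base.symm, fun i hi j hj he => (hf.disj j hj i hi he.symm).symm⟩

/-- The index sequence that follows `σ` backwards from `A` and then `τ` forwards. -/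
def joinIdx (σ τ : ℕ → ι) (A : ℕ) : ℕ → ι := fun i => if i ≤ A then σ (A - i) else τ (i - A)

theorem Fork.one_join {σ τ : ℕ → ι} {ω : ι → V} {A B A' B' : ℕ}
    (hf : G.Fork (ω ∘ σ) (ω ∘ τ) A B) (hA : A' ≤ A) (hB : B' ≤ B)
    (hb : ∀ i < A', ∀ j < B', stepEdge (ω ∘ τ) j ∈ G.bl (stepEdge (ω ∘ σ) i) → i = 0 ∧ j = 0) :
    G.One (ω ∘ joinIdx σ τ A') (A' + B') := by
  set ρ := ω ∘ joinIdx σ τ A' with hρ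
  have v1 : ∀ i ≤ A', ρ i = (ω ∘ σ) (A' - i) := fun i hi => by
    simp only [hρ, joinIdx, Function.comp, if_pos hi]
  have v2 : ∀ i, A' ≤ i → ρ i = (ω ∘ τ) (i - A') := fun i hi => by
    rcases hi.eq_or_lt with rfl | h1
    · rw [v1 _ le_rfl, Nat.sub_self, hf.base]
    · simp only [hρ, joinIdx, Function.comp, if_neg (not_le.2 h1)]
  have e1 : ∀ i < A', stepEdge ρ i = stepEdge (ω ∘ σ) (A' - 1 - i) := fun i hi => by
    rw [stepEdge, stepEdge, v1 i hi.le, v1 (i + 1) hi, Sym2.eq_swap,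
      show A' - (i + 1) = A' - 1 - i by omega, show A' - i = A' - 1 - i + 1 by omega]
  have e2 : ∀ i, A' ≤ i → stepEdge ρ i = stepEdge (ω ∘ τ) (i - A') := fun i hi => by
    rw [stepEdge, stepEdge, v2 i hi, v2 (i + 1) (by omega), Nat.sub_add_comm hi]
  refine ⟨⟨fun i hi => ?_, fun i hi j hj he => ?_⟩, ?_⟩
  · rw [← SimpleGraph.mem_edgeSet]
    change stepEdge ρ i ∈ _
    rcases lt_or_ge i A' with h2 | h2
    · rw [e1 i h2]; exact hf.left.1.1 _ (by omega)
    · rw [e2 i h2]; exact hf.right.1.1 _ (by omega)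
  · rcases le_total i A' with h2 | h2 <;> rcases le_total j A' with h3 | h3
    · rw [v1 i h2, v1 j h3] at he
      have := hf.left.1.2 _ (by omega) _ (by omega) he
      omega
    · rw [v1 i h2, v2 j h3] at he
      have := hf.disj _ (by omega) _ (by omega) he
      omega
    · rw [v2 i h2, v1 j h3] at he
      have := hf.disj _ (by omega) _ (by omega) he.symm
      omega
    · rw [v2 i h2, v2 j h3] at he
      have := hf.right.1.2 _ (by omega) _ (by omega) he
      omega
  · have key : ∀ i j, i < j → j < A' + B' → stepEdge ρ j ∈ G.bl (stepEdge ρ i) →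
        i + 1 = A' ∧ j = A' := by
      intro i j hij hj hbl
      rcases lt_or_ge i A' with h2 | h2 <;> rcases lt_or_ge j A' with h3 | h3
      · rw [e1 i h2, e1 j h3] at hbl
        exact absurd hbl (hf.left.not_mem (by omega) (by omega) (by omega))
      · rw [e1 i h2, e2 j h3] at hbl
        have := hb _ (by omega) _ (by omega) hbl
        omega
      · omega
      · rw [e2 i h2, e2 j h3] at hbl
        exact absurd hbl (hf.right.not_mem (by omega) (by omega) (by omega))
    intro i j i' j' h1 h2 h3 h4 h5 h6
    have := key i j h1 h2 h5
    have := key i' j' h3 h4 h6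
    omega

/-- Walking a path backwards. -/
theorem back_bound {S : Set (ι → V)} {σ : ℕ → ι} {A : ℕ} (hS : ∀ ω ∈ S, G.IsPth (ω ∘ σ) A)
    (i : ℕ) (hi : i ≤ A) : DetBound S {σ A} (σ '' Set.Icc i A) (D ^ (A - i)) := by
  refine (ext_bound (G := G) (fun x => σ (A - x)) (A - i) fun ω hω x hx => ?_).mono
    (by simp) ?_ le_rfl
  · have := (hS ω hω).1 (A - (x + 1)) (by omega)
    rw [show A - (x + 1) + 1 = A - x by omega] at this
    exact this.symm
  · rintro _ ⟨x, hx, rfl⟩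
    rw [Set.mem_Icc] at hx
    exact Or.inr ⟨A - x, by simp only [Set.mem_Iic]; omega, by simp only; congr 1; omega⟩

theorem fork_bound_aux {S : Set (ι → V)} {σ τ : ℕ → ι} {A B : ℕ}
    (hS : ∀ ω ∈ S, G.Fork (ω ∘ σ) (ω ∘ τ) A B) (hAB : A ≤ B) (hB : B ≤ 2 * h + 1)
    (hF : (2 * h + 1) * (2 * h + 1) * (2 * (f + 1)) ≤ F) :
    DetBound S {σ A, τ B} (σ '' Set.Iic A ∪ τ '' Set.Iic B) (D ^ A * F ^ (B - 1)) := by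
  have b1 : DetBound S {σ A, τ B} (σ '' Set.Iic A) (D ^ A) := by
    refine (back_bound (fun ω hω => (hS ω hω).left.1) 0 (Nat.zero_le _)).mono (by simp) ?_ le_rfl
    rw [show Set.Icc 0 A = Set.Iic A by ext; simp]
    exact Set.subset_union_right
  have b2 := b1.trans (J' := {σ A, τ B, τ 0} ∪ σ '' Set.Iic A)
    (DetBound.of_eq (S := S) (x := σ 0) (y := τ 0) fun ω hω => (hS ω hω).base)
    (by rintro _ rfl; exact Or.inr ⟨0, by simp, rfl⟩)
    (by
      rintro x ((rfl | rfl | rfl) | hx)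
      · simp
      · simp
      · simp
      · exact Or.inl (Or.inr hx))
  have b3 := b2.trans (J' := σ '' Set.Iic A ∪ τ '' Set.Iic B)
    ((unb_bound (G := G) hF hB).comap τ fun ω hω => (hS ω hω).right)
    (by
      rintro _ ⟨x, rfl | rfl, rfl⟩ <;> simp)
    (by
      rintro x (hx | hx)
      · exact Or.inl (Or.inr (Or.inr hx))
      · exact Or.inr hx)
  simpa using b3

theorem fork_bound {S : Set (ι → V)} {σ τ : ℕ → ι} {A B : ℕ}
    (hS : ∀ ω ∈ S, G.Fork (ω ∘ σ) (ω ∘ τ) A B) (hA : A ≤ 2 * h + 1) (hB : B ≤ 2 * h + 1)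
    (hF : (2 * h + 1) * (2 * h + 1) * (2 * (f + 1)) ≤ F) :
    DetBound S {σ A, τ B} (σ '' Set.Iic A ∪ τ '' Set.Iic B)
      (D ^ (min A B) * F ^ (max A B - 1)) := by
  rcases le_total A B with hAB | hAB
  · rw [min_eq_left hAB, max_eq_right hAB]
    exact fork_bound_aux hS hAB hB hF
  · rw [min_eq_right hAB, max_eq_left hAB, Set.pair_comm, Set.union_comm]
    exact fork_bound_aux (fun ω hω => (hS ω hω).swap) hAB hA hF

theorem two_mul_le_of_le (hF : (2 * h + 1) * (2 * h + 1) * (2 * (f + 1)) ≤ F) : 2 * f ≤ F :=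
  calc 2 * f ≤ 1 * (2 * (f + 1)) := by omega
    _ ≤ (2 * h + 1) * (2 * h + 1) * (2 * (f + 1)) :=
      Nat.mul_le_mul_right _ (Nat.succ_le_of_lt (by positivity))
    _ ≤ F := hF

theorem fork_insert_base {S : Set (ι → V)} {σ τ : ℕ → ι} {A B N : ℕ} {I : Set ι}
    (hS : ∀ ω ∈ S, G.Fork (ω ∘ σ) (ω ∘ τ) A B)
    (hb : DetBound S I (σ '' Set.Iic A ∪ τ '' Set.Ioc 0 B) N) :
    DetBound S I (σ '' Set.Iic A ∪ τ '' Set.Iic B) N := by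
  rw [← mul_one N]
  refine hb.trans (DetBound.of_eq (S := S) (x := σ 0) (y := τ 0) fun ω hω => (hS ω hω).base) ?_ ?_
  · rintro _ rfl
    exact Or.inr (Or.inl ⟨0, by simp, rfl⟩)
  · rintro _ (hx | ⟨y, hy, rfl⟩)
    · exact Or.inl (Or.inr (Or.inl hx))
    · rcases Nat.eq_zero_or_pos y with rfl | h1
      · exact Or.inr rfl
      · exact Or.inl (Or.inr (Or.inr ⟨y, ⟨h1, hy⟩, rfl⟩))

theorem fork_bound_blocked_aux {S : Set (ι → V)} {σ τ : ℕ → ι} {A B i j : ℕ}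
    (hS : ∀ ω ∈ S, G.Fork (ω ∘ σ) (ω ∘ τ) A B) (hB : B ≤ h)
    (hF : (2 * h + 1) * (2 * h + 1) * (2 * (f + 1)) ≤ F) (hFD : F ≤ D)
    (hi : 1 ≤ i) (hj : 1 ≤ j) (hiA : i < A) (hjB : j < B) (hij : i + j ≤ h + 1)
    (hle : A - 1 - i ≤ B - 1 - j)
    (hbl : ∀ ω ∈ S, stepEdge (ω ∘ τ) j ∈ G.bl (stepEdge (ω ∘ σ) i))
    (hmin : ∀ ω ∈ S, ∀ i' < i, ∀ j' < j,
      stepEdge (ω ∘ τ) j' ∈ G.bl (stepEdge (ω ∘ σ) i') → i' = 0 ∧ j' = 0) :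
    DetBound S {σ A, τ B} (σ '' Set.Iic A ∪ τ '' Set.Iic B)
      (D ^ (min A B - 1) * F ^ (max A B)) := by
  have hF1 : 1 ≤ F := le_trans (by nlinarith) hF
  have hF2 : 2 * f ≤ F := two_mul_le_of_le hF
  have b1 := (back_bound (G := G) (fun ω hω => (hS ω hω).left.1) i hiA.le)
  have b2 := b1.trans (J' := σ '' Set.Icc i A ∪ {τ j, τ (j + 1)})
    (block_bound (G := G) (S := S) (σ i) (σ (i + 1)) (τ j) (τ (j + 1)) hbl hF2)
    (by
      rintro x (rfl | rfl)
      · exact Or.inr ⟨i, by simp; omega, rfl⟩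
      · exact Or.inr ⟨i + 1, by simp; omega, rfl⟩)
    (by
      rintro x (hx | hx)
      · exact Or.inl (Or.inr hx)
      · exact Or.inr hx)
  have b2' := b2.mono (I' := {σ A, τ B}) (J' := σ '' Set.Icc i A ∪ {τ j, τ (j + 1)})
    (by simp) Set.subset_union_right le_rfl
  have b3 := b2'.trans (J' := σ '' Set.Icc i A ∪ τ '' Set.Icc j B)
    ((unb_bound (G := G) hF (m := B - (j + 1)) (by omega)).comap (fun x => τ (j + 1 + x))
      fun ω hω => (hS ω hω).right.window (by omega))
    (by
      rintro _ ⟨x, rfl | rfl, rfl⟩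
      · simp
      · simp only [show j + 1 + (B - (j + 1)) = B by omega]; simp)
    (by
      rintro x (hx | ⟨y, hy, rfl⟩)
      · exact Or.inl (Or.inr (Or.inl hx))
      · rw [Set.mem_Icc] at hy
        rcases hy.1.eq_or_lt with rfl | h1
        · simp
        · exact Or.inr ⟨y - (j + 1), by simp only [Set.mem_Iic]; omega,
            by simp only; congr 1; omega⟩)
  have b4 := b3.trans (J' := σ '' Set.Iic A ∪ τ '' Set.Ioc 0 B)
    ((one_bound (G := G) hF hij).comap (joinIdx σ τ i)
      fun ω hω => (hS ω hω).one_join hiA.le hjB.le (hmin ω hω))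
    (by
      rintro _ ⟨x, rfl | rfl, rfl⟩
      · refine Or.inr (Or.inl ⟨i, by simp; omega, by simp [joinIdx]⟩)
      · exact Or.inr (Or.inr ⟨j, by simp; omega, by simp [joinIdx]; omega⟩))
    (by
      rintro _ (⟨y, hy, rfl⟩ | ⟨y, hy, rfl⟩)
      · rw [Set.mem_Iic] at hy
        rcases le_total i y with h1 | h1
        · exact Or.inl (Or.inr (Or.inl ⟨y, ⟨h1, hy⟩, rfl⟩))
        · refine Or.inr ⟨i - y, by simp only [Set.mem_Iic]; omega, ?_⟩
          simp only [joinIdx, if_pos (Nat.sub_le i y)]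
          congr 1; omega
      · rw [Set.mem_Ioc] at hy
        rcases le_total j y with h1 | h1
        · exact Or.inl (Or.inr (Or.inr ⟨y, ⟨h1, hy.2⟩, rfl⟩))
        · refine Or.inr ⟨i + y, by simp only [Set.mem_Iic]; omega, ?_⟩
          simp only [joinIdx, if_neg (show ¬ i + y ≤ i by omega)]
          congr 1; omega)
  refine fork_insert_base hS (b4.mono_num ?_)
  calc D ^ (A - i) * F * F ^ (B - (j + 1) - 1) * F ^ (i + j - 1)
      = D ^ (A - i) * F ^ (1 + (B - (j + 1) - 1) + (i + j - 1)) := by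
        rw [pow_add, pow_add, pow_one]; ring
    _ ≤ _ := pow_mul_pow_le_of_le hF1 hFD (by omega) (by omega)

theorem fork_bound_free_aux {S : Set (ι → V)} {σ τ : ℕ → ι} {A B : ℕ}
    (hS : ∀ ω ∈ S, G.Fork (ω ∘ σ) (ω ∘ τ) A B) (hA : A ≤ h) (hB : B ≤ h)
    (hF : (2 * h + 1) * (2 * h + 1) * (2 * (f + 1)) ≤ F) (hFD : F ≤ D)
    (hA1 : 1 ≤ A) (hB1 : 1 ≤ B)
    (hbl : ∀ ω ∈ S, ∀ i < A, ∀ j < B, i + j ≤ h + 1 →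
      stepEdge (ω ∘ τ) j ∈ G.bl (stepEdge (ω ∘ σ) i) → i = 0 ∧ j = 0) :
    DetBound S {σ A, τ B} (σ '' Set.Iic A ∪ τ '' Set.Iic B)
      (D ^ (min A B - 1) * F ^ (max A B)) := by
  have hF1 : 1 ≤ F := le_trans (by nlinarith) hF
  obtain ⟨B', hB'⟩ : ∃ B', B' = min B (h + 1 - A) := ⟨_, rfl⟩
  have b1 := ((back_bound (G := G) (fun ω hω => (hS ω hω).right.1) B' (by omega))).mono
    (I' := {σ A, τ B}) (J' := {σ A} ∪ τ '' Set.Icc B' B) (by simp)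
    (by
      rintro x (rfl | hx)
      · simp
      · exact Or.inr hx) le_rfl
  have b2 := b1.trans (J' := σ '' Set.Iic A ∪ τ '' Set.Ioc 0 B)
    ((one_bound (G := G) hF (m := A + B') (by omega)).comap (joinIdx σ τ A)
      fun ω hω => (hS ω hω).one_join le_rfl (show B' ≤ B by omega) fun i hi j hj =>
        hbl ω hω i hi j (by omega) (by omega))
    (by
      rintro _ ⟨x, rfl | rfl, rfl⟩
      · exact Or.inl (by simp [joinIdx])
      · exact Or.inr (Or.inr ⟨B', by simp; omega, by simp [joinIdx]; omega⟩))
    (by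
      rintro _ (⟨y, hy, rfl⟩ | ⟨y, hy, rfl⟩)
      · rw [Set.mem_Iic] at hy
        refine Or.inr ⟨A - y, by simp only [Set.mem_Iic]; omega, ?_⟩
        simp only [joinIdx, if_pos (Nat.sub_le A y)]
        congr 1; omega
      · rw [Set.mem_Ioc] at hy
        rcases le_total B' y with h1 | h1
        · exact Or.inl (Or.inr (Or.inr ⟨y, ⟨h1, hy.2⟩, rfl⟩))
        · refine Or.inr ⟨A + y, by simp only [Set.mem_Iic]; omega, ?_⟩
          simp only [joinIdx, if_neg (show ¬ A + y ≤ A by omega)]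
          congr 1; omega)
  exact fork_insert_base hS (b2.mono_num
    (pow_mul_pow_le_of_le hF1 hFD (by omega) (by omega)))

/-- In a fork whose two first edges can be blocked only with each other, one factor `D` of
`fork_bound` can be traded for a factor `F`. -/
theorem fork_bound_refined {S : Set (ι → V)} {σ τ : ℕ → ι} {A B : ℕ}
    (hS : ∀ ω ∈ S, G.Fork (ω ∘ σ) (ω ∘ τ) A B) (hA : A ≤ h) (hB : B ≤ h)
    (hF : (2 * h + 1) * (2 * h + 1) * (2 * (f + 1)) ≤ F) (hFD : F ≤ D)
    (hA1 : 1 ≤ A) (hB1 : 1 ≤ B)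
    (hbl : ∀ ω ∈ S, ∀ i < A, ∀ j < B,
      stepEdge (ω ∘ τ) j ∈ G.bl (stepEdge (ω ∘ σ) i) → (i = 0 ↔ j = 0)) :
    DetBound S {σ A, τ B} (σ '' Set.Iic A ∪ τ '' Set.Iic B)
      ((h + 1) * (h + 1) * (D ^ (min A B - 1) * F ^ (max A B))) := by
  classical
  let Q : (ι → V) → ℕ × ℕ → Prop := fun ω c => 1 ≤ c.1 ∧ 1 ≤ c.2 ∧ c.1 < A ∧ c.2 < B ∧
    c.1 + c.2 ≤ h + 1 ∧ stepEdge (ω ∘ τ) c.2 ∈ G.bl (stepEdge (ω ∘ σ) c.1)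
  let R : ℕ × ℕ → Set (ι → V) := fun c =>
    {ω | if c = (0, 0) then ∀ c', ¬ Q ω c' else Q ω c ∧ ∀ c', Q ω c' → c.1 + c.2 ≤ c'.1 + c'.2}
  refine (DetBound.biUnion (Finset.range (h + 1) ×ˢ Finset.range (h + 1)) R
    (N := D ^ (min A B - 1) * F ^ (max A B)) ?_ ?_).mono_num
    (by rw [Finset.card_product, Finset.card_range])
  · intro ω _
    by_cases hex : ∃ n c, c.1 + c.2 = n ∧ Q ω c
    · obtain ⟨c, hc, hQ⟩ := Nat.find_spec hex
      refine ⟨c, ?_, ?_⟩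
      · simp only [Finset.mem_product, Finset.mem_range]
        have h1 := hQ.2.2.1
        have h2 := hQ.2.2.2.1
        omega
      · have hne : c ≠ (0, 0) := by
          rintro rfl
          exact absurd hQ.1 (by simp)
        simp only [R, Set.mem_ofPred_eq, if_neg hne]
        exact ⟨hQ, fun c' hc' => hc ▸ Nat.find_min' hex ⟨c', rfl, hc'⟩⟩
    · refine ⟨(0, 0), by simp, ?_⟩
      simp only [R, Set.mem_ofPred_eq, if_true]
      exact fun c' hc' => hex ⟨_, c', rfl, hc'⟩
  · intro c _
    by_cases hc : c = (0, 0)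
    · refine fork_bound_free_aux (fun ω hω => hS ω hω.1) hA hB hF hFD hA1 hB1 ?_
      intro ω hω i hi j hj hij he
      have h1 : ∀ c', ¬ Q ω c' := by simpa [R, hc] using hω.2
      have h2 := hbl ω hω.1 i hi j hj he
      by_contra h3
      exact h1 (i, j) ⟨by simp only; omega, by simp only; omega, hi, hj, hij, he⟩
    · have hR : ∀ ω ∈ S ∩ R c, Q ω c ∧ ∀ c', Q ω c' → c.1 + c.2 ≤ c'.1 + c'.2 := by
        intro ω hω
        have := hω.2
        simpa only [R, Set.mem_ofPred_eq, if_neg hc] using this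
      by_cases hne : (S ∩ R c).Nonempty
      swap
      · intro ω hω
        exact absurd ⟨ω, hω⟩ hne
      obtain ⟨ω₁, h₁⟩ := hne
      obtain ⟨⟨q1, q2, q3, q4, q5, -⟩, -⟩ := hR ω₁ h₁
      have hmin : ∀ ω ∈ S ∩ R c, ∀ i' < c.1, ∀ j' < c.2,
          stepEdge (ω ∘ τ) j' ∈ G.bl (stepEdge (ω ∘ σ) i') → i' = 0 ∧ j' = 0 := by
        intro ω hω i hi j hj he
        have h2 := hbl ω hω.1 i (by omega) j (by omega) he
        by_contra h3
        have := (hR ω hω).2 (i, j)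
          ⟨by simp only; omega, by simp only; omega, by simp only; omega, by simp only; omega,
            by simp only; omega, he⟩
        simp only at this
        omega
      rcases le_total (A - 1 - c.1) (B - 1 - c.2) with hle | hle
      · exact fork_bound_blocked_aux (fun ω hω => hS ω hω.1) hB hF hFD q1 q2 q3 q4 q5 hle
          (fun ω hω => (hR ω hω).1.2.2.2.2.2) hmin
      · rw [Set.pair_comm, Set.union_comm, min_comm, max_comm]
        exact fork_bound_blocked_aux (fun ω hω => (hS ω hω.1).swap) hA hF hFD q2 q1 q4 q3
          (by omega) hle (fun ω hω => G.bl_symm _ _ (hR ω hω).1.2.2.2.2.2)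
          fun ω hω i hi j hj he => (hmin ω hω j hj i hi (G.bl_symm _ _ he)).symm

end BlockedGraph

namespace BlockedGraph

variable {V ι : Type} {h f D F : ℕ} {G : BlockedGraph V h f D} {p q ω : ℕ → V}

/-- An unblocked path with `2h+1` edges whose middle edge has maximal rank and in which no edge is
blocked with an edge incident to a vertex that is further away from the middle. -/
structure Good (G : BlockedGraph V h f D) (p : ℕ → V) : Prop where
  unb : G.Unb p (2 * h + 1)
  rank_le : ∀ i < 2 * h + 1, G.rank (stepEdge p i) ≤ G.rank (stepEdge p h)
  right : ∀ i j, h ≤ i → i + 2 ≤ j → j ≤ 2 * h + 1 → ∀ e ∈ G.bl (stepEdge p i), p j ∉ e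
  left : ∀ i j, i ≤ h → j < i → ∀ e ∈ G.bl (stepEdge p i), p j ∉ e

/-- Two good paths that share their vertex `j`, separate, and meet again after `ℓ₁` and `ℓ₂` steps
respectively; the edges `α` and `β` of the two segments in between are blocked. -/
structure Meet (G : BlockedGraph V h f D) (p q : ℕ → V) (j ℓ₁ ℓ₂ α β : ℕ) : Prop where
  good_left : G.Good p
  good_right : G.Good q
  le_left : j + ℓ₁ ≤ 2 * h + 1
  le_right : j + ℓ₂ ≤ 2 * h + 1
  base : p j = q j
  top : p (j + ℓ₁) = q (j + ℓ₂)
  disj : ∀ i ≤ ℓ₁, ∀ i' ≤ ℓ₂, p (j + i) = q (j + i') → (i = 0 ∧ i' = 0) ∨ (i = ℓ₁ ∧ i' = ℓ₂)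
  lt_left : α < ℓ₁
  lt_right : β < ℓ₂
  blocked : stepEdge q (j + β) ∈ G.bl (stepEdge p (j + α))

variable {j ℓ₁ ℓ₂ α β : ℕ}

theorem Meet.swap (hm : G.Meet p q j ℓ₁ ℓ₂ α β) : G.Meet q p j ℓ₂ ℓ₁ β α :=
  ⟨hm.good_right, hm.good_left, hm.le_right, hm.le_left, hm.base.symm, hm.top.symm,
    fun i hi i' hi' he => (hm.disj i' hi' i hi he.symm).imp And.symm And.symm,
    hm.lt_right, hm.lt_left, G.bl_symm _ _ hm.blocked⟩

theorem stepEdge_back (ω : ℕ → V) {m i : ℕ} (hi : i < m) :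
    stepEdge (fun x => ω (m - x)) i = stepEdge ω (m - 1 - i) := by
  rw [stepEdge, stepEdge, Sym2.eq_swap, show m - (i + 1) = m - 1 - i by omega,
    show m - i = m - 1 - i + 1 by omega]

theorem Unb.back {M : ℕ} (hp : G.Unb ω M) {m m' : ℕ} (h1 : m' ≤ m) (h2 : m ≤ M) :
    G.Unb (fun i => ω (m - i)) m' := by
  refine ⟨⟨fun i hi => ?_, fun i hi i' hi' he => ?_⟩, fun i i' hi hi' => ?_⟩
  · rw [← SimpleGraph.mem_edgeSet]
    change stepEdge (fun x => ω (m - x)) i ∈ _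
    rw [stepEdge_back ω (by omega)]
    exact hp.1.1 _ (by omega)
  · have := hp.1.2 _ (by omega) _ (by omega) he
    omega
  · rw [stepEdge_back ω (by omega), stepEdge_back ω (by omega)]
    exact hp.not_mem (by omega) (by omega) (by omega)

theorem Meet.fork_base (hm : G.Meet p q j ℓ₁ ℓ₂ α β) :
    G.Fork (fun i => p (j + i)) (fun i => q (j + i)) α β := by
  have h1 := hm.lt_left
  have h2 := hm.lt_right
  have h3 := hm.le_left
  have h4 := hm.le_right
  refine ⟨hm.good_left.unb.window (by omega), hm.good_right.unb.window (by omega), hm.base, ?_⟩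
  intro i hi i' hi' he
  have := hm.disj i (by omega) i' (by omega) he
  omega

theorem Meet.fork_top (hm : G.Meet p q j ℓ₁ ℓ₂ α β) :
    G.Fork (fun i => p (j + ℓ₁ - i)) (fun i => q (j + ℓ₂ - i)) (ℓ₁ - 1 - α) (ℓ₂ - 1 - β) := by
  have h1 := hm.lt_left
  have h2 := hm.lt_right
  have h3 := hm.le_left
  have h4 := hm.le_right
  refine ⟨hm.good_left.unb.back (by omega) h3, hm.good_right.unb.back (by omega) h4, hm.top, ?_⟩
  intro i hi i' hi' he
  rw [show j + ℓ₁ - i = j + (ℓ₁ - i) by omega, show j + ℓ₂ - i' = j + (ℓ₂ - i') by omega] at he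
  have := hm.disj _ (by omega) _ (by omega) he
  omega

theorem Meet.base_blocked (hm : G.Meet p q j ℓ₁ ℓ₂ α β) {i i' : ℕ} (hi : j + i ≤ h)
    (hbl : stepEdge (fun i => q (j + i)) i' ∈ G.bl (stepEdge (fun i => p (j + i)) i))
    (h0 : i' = 0) : i = 0 := by
  by_contra h1
  refine hm.good_left.left (j + i) j hi (by omega) _ hbl ?_
  subst h0
  rw [hm.base]
  exact Sym2.mem_mk_left _ _

theorem Meet.top_blocked (hm : G.Meet p q j ℓ₁ ℓ₂ α β) {i i' : ℕ} (hi : h + i + 1 ≤ j + ℓ₁)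
    (hbl : stepEdge (fun i => q (j + ℓ₂ - i)) i' ∈ G.bl (stepEdge (fun i => p (j + ℓ₁ - i)) i))
    (h0 : i' = 0) : i = 0 := by
  by_contra h1
  rw [stepEdge_back _ (by omega)] at hbl
  refine hm.good_left.right (j + ℓ₁ - 1 - i) (j + ℓ₁) (by omega) (by omega) hm.le_left _ hbl ?_
  subst h0
  rw [hm.top]
  exact Sym2.mem_mk_left _ _

theorem tail_bound {S : Set (ι → V)} {s : ℕ → ι} {k m : ℕ}
    (hS : ∀ ω ∈ S, G.IsPth (ω ∘ s) k) (hjm : j ≤ m) (hm : m ≤ k) :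
    DetBound S (s '' Set.Icc j m) (s '' Set.Iic k) (D ^ (k - (m - j))) := by
  have b1 := ext_bound (G := G) (S := S) (fun x => s (j - x)) j fun ω hω x hx => by
    have := (hS ω hω).1 (j - (x + 1)) (by omega)
    rw [show j - (x + 1) + 1 = j - x by omega] at this
    exact this.symm
  have b2 := ext_bound (G := G) (S := S) (fun x => s (m + x)) (k - m) fun ω hω x hx =>
    (hS ω hω).1 (m + x) (by omega)
  have b3 := (b1.mono (I' := s '' Set.Icc j m) (by
      rintro _ rfl
      exact ⟨j, by simp [hjm], by simp⟩) Set.subset_union_right le_rfl).trans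
    (J' := s '' Set.Iic k) b2 (by
      rintro _ rfl
      exact Or.inl ⟨m, by simp [hjm], by simp⟩) (by
      rintro _ ⟨y, hy, rfl⟩
      rw [Set.mem_Iic] at hy
      rcases lt_or_ge y j with h1 | h1
      · exact Or.inl (Or.inr ⟨j - y, by simp, by simp only; congr 1; omega⟩)
      · rcases le_total y m with h2 | h2
        · exact Or.inl (Or.inl ⟨y, ⟨h1, h2⟩, rfl⟩)
        · exact Or.inr ⟨y - m, by simp only [Set.mem_Iic]; omega, by simp only; congr 1; omega⟩)
  refine b3.mono_num (le_of_eq ?_)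
  rw [← pow_add]
  congr 1
  omega

theorem Meet.assemble [Fintype V] {S : Set (ι → V)} {s t : ℕ → ι} {N₁ N₂ : ℕ}
    (hS : ∀ ω ∈ S, G.Meet (ω ∘ s) (ω ∘ t) j ℓ₁ ℓ₂ α β) (hα : α < ℓ₁) (hβ : β < ℓ₂)
    (hF : 2 * f ≤ F)
    (h₁ : DetBound S {s (j + α), t (j + β)}
      ((fun x => s (j + x)) '' Set.Iic α ∪ (fun x => t (j + x)) '' Set.Iic β) N₁)
    (h₂ : DetBound S {s (j + α + 1), t (j + β + 1)}
      ((fun x => s (j + ℓ₁ - x)) '' Set.Iic (ℓ₁ - 1 - α) ∪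
        (fun x => t (j + ℓ₂ - x)) '' Set.Iic (ℓ₂ - 1 - β)) N₂) :
    DetBound S ∅ (s '' Set.Icc j (j + ℓ₁) ∪ t '' Set.Icc j (j + ℓ₂))
      (Fintype.card V * D * F * N₁ * N₂) := by
  classical
  have c0 : DetBound S ∅ {s (j + α)} (Fintype.card V) :=
    DetBound.single _ (fun _ => Finset.univ) (fun _ _ => le_rfl) fun _ _ _ _ _ => Finset.mem_univ _
  have c1 := ext_bound (G := G) (S := S) (fun x => s (j + α + x)) 1 fun ω hω x hx => by
    have h3 := (hS ω hω).le_left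
    exact (hS ω hω).good_left.unb.1.1 (j + α + x) (by omega)
  rw [pow_one] at c1
  have c2 := c0.trans (J' := {s (j + α), s (j + α + 1)}) c1 (by simp) (by
    rintro x (rfl | rfl)
    · simp
    · exact Or.inr ⟨1, by simp, rfl⟩)
  have c3 := c2.trans (J' := {s (j + α), s (j + α + 1), t (j + β), t (j + β + 1)})
    (block_bound (G := G) (S := S) (s (j + α)) (s (j + α + 1)) (t (j + β)) (t (j + β + 1))
      (fun ω hω => (hS ω hω).blocked) hF) (by simp) (by
    rintro x (rfl | rfl | rfl | rfl) <;> simp)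
  have c4 := c3.trans (J' := {s (j + α + 1), t (j + β + 1)} ∪
      ((fun x => s (j + x)) '' Set.Iic α ∪ (fun x => t (j + x)) '' Set.Iic β)) h₁ (by
    rintro x (rfl | rfl) <;> simp) (by
    rintro x ((rfl | rfl) | hx)
    · simp
    · simp
    · exact Or.inr hx)
  refine c4.trans h₂ (by
    rintro x (rfl | rfl) <;> simp) ?_
  rintro _ (⟨y, hy, rfl⟩ | ⟨y, hy, rfl⟩) <;> rw [Set.mem_Icc] at hy
  · rcases Nat.lt_or_ge (j + α) y with h3 | h3
    · exact Or.inr (Or.inl ⟨j + ℓ₁ - y, by simp only [Set.mem_Iic]; omega,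
        by simp only; congr 1; omega⟩)
    · exact Or.inl (Or.inr (Or.inr (Or.inl ⟨y - j, by simp only [Set.mem_Iic]; omega,
        by simp only; congr 1; omega⟩)))
  · rcases Nat.lt_or_ge (j + β) y with h3 | h3
    · exact Or.inr (Or.inr ⟨j + ℓ₂ - y, by simp only [Set.mem_Iic]; omega,
        by simp only; congr 1; omega⟩)
    · exact Or.inl (Or.inr (Or.inr (Or.inr ⟨y - j, by simp only [Set.mem_Iic]; omega,
        by simp only; congr 1; omega⟩)))

theorem mul_pow_mul_pow_le {X L a b : ℕ} (hX : X * F ^ (h + 1) ≤ D) (hX1 : 1 ≤ X) (hF : 1 ≤ F)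
    (hab : (a + 1 ≤ L ∧ a + b ≤ h + L) ∨ (a + 2 ≤ L ∧ a + b ≤ 2 * h + L)) :
    X * (D ^ a * F ^ b) ≤ D ^ L := by
  have hFD : F ≤ D := le_trans (by
    calc F = 1 * F ^ 1 := by ring
      _ ≤ X * F ^ (h + 1) := Nat.mul_le_mul hX1 (Nat.pow_le_pow_right hF (by omega))) hX
  rcases hab with ⟨h1, h2⟩ | ⟨h1, h2⟩
  · obtain ⟨c, rfl⟩ := Nat.exists_eq_add_of_le h1
    calc X * (D ^ a * F ^ b) ≤ X * (D ^ a * F ^ (h + 1 + c)) := by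
          gcongr
          omega
      _ = D ^ a * (X * F ^ (h + 1)) * F ^ c := by rw [pow_add F]; ring
      _ ≤ D ^ a * D * D ^ c := by gcongr
      _ = D ^ (a + 1 + c) := by rw [pow_add, pow_add, pow_one]
  · obtain ⟨c, rfl⟩ := Nat.exists_eq_add_of_le h1
    calc X * (D ^ a * F ^ b) ≤ X * X * (D ^ a * F ^ (h + 1 + (h + 1) + c)) := by
          gcongr
          · exact Nat.le_mul_of_pos_left _ hX1
          · omega
      _ = D ^ a * ((X * F ^ (h + 1)) * (X * F ^ (h + 1))) * F ^ c := by
          rw [pow_add F, pow_add F]; ring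
      _ ≤ D ^ a * (D * D) * D ^ c := by gcongr
      _ = D ^ (a + 2 + c) := by rw [pow_add, pow_add]; ring

theorem exponents_of_short {h j ℓ₁ ℓ₂ α β A B a₁ b₁ a₂ b₂ : ℕ}
  (hcase : ((ℓ₁ ≤ h + 1 ∨ ℓ₂ ≤ h + 1) ∧ (α ≠ β ∨ ℓ₁ ≠ ℓ₂)))
  (hα : α < ℓ₁) (hβ : β < ℓ₂) (hr : j + ℓ₂ ≤ 2 * h + 1)
  (hA : A + 1 + α = ℓ₁) (hB : B + 1 + β = ℓ₂)
  (n₁ : ((a₁ = min α β ∧ b₁ = max α β - 1) ∨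
        (a₁ + 1 = min α β ∧ b₁ = max α β)))
  (n₂ : ((a₂ = min A B ∧ b₂ = max A B - 1) ∨
        (a₂ + 1 = min A B ∧ b₂ = max A B))) :
  (1 + a₁ + a₂ + 1 ≤ max ℓ₁ ℓ₂ ∧ 1 + a₁ + a₂ + (1 + b₁ + b₂) ≤ h + max ℓ₁ ℓ₂) := by
  omega
theorem exponents_of_long {h j ℓ₁ ℓ₂ α β A B a₁ b₁ a₂ b₂ : ℕ}
  (h1 : h + 2 ≤ ℓ₁) (h2 : h + 2 ≤ ℓ₂) (h3 : j + α = h)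
  (hα : α < ℓ₁) (hβ : β < ℓ₂) (hl : j + ℓ₁ ≤ 2 * h + 1) (hr : j + ℓ₂ ≤ 2 * h + 1)
  (hA : A + 1 + α = ℓ₁) (hB : B + 1 + β = ℓ₂)
  (n₁ : ((a₁ = min α β ∧ b₁ = max α β - 1 ∧ (β = 0 ∨ h < j + β)) ∨
        (a₁ + 1 = min α β ∧ b₁ = max α β ∧ 1 ≤ β ∧ j + β ≤ h)))
  (n₂ : ((a₂ = min A B ∧ b₂ = max A B - 1 ∧ (B = 0 ∨ j + β < h)) ∨
        (a₂ + 1 = min A B ∧ b₂ = max A B ∧ 1 ≤ B ∧ h ≤ j + β)))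
  :
  (1 + a₁ + a₂ + 1 ≤ max ℓ₁ ℓ₂ ∧ 1 + a₁ + a₂ + (1 + b₁ + b₂) ≤ h + max ℓ₁ ℓ₂) ∨
      (1 + a₁ + a₂ + 2 ≤ max ℓ₁ ℓ₂ ∧ 1 + a₁ + a₂ + (1 + b₁ + b₂) ≤ 2 * h + max ℓ₁ ℓ₂) := by
  rcases le_total α β with x | x <;> rcases le_total A B with y | y <;>
  rcases le_total ℓ₁ ℓ₂ with z | z <;>
  simp only [min_eq_left, max_eq_right, min_eq_right, max_eq_left, x, y, z] at n₁ n₂ ⊢ <;>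
  rcases n₁ with n₁ | n₁ <;> rcases n₂ with n₂ | n₂ <;> omega

/-- The number of ways in which a good path can meet another good path with prescribed
position data is small compared to `|V| D ^ (2h+1)`. -/
theorem Meet.bound_aux [Fintype V] {S : Set (ι → V)} {s t : ℕ → ι} {X : ℕ}
    (hS : ∀ ω ∈ S, G.Meet (ω ∘ s) (ω ∘ t) j ℓ₁ ℓ₂ α β) (hX : X * F ^ (h + 1) ≤ D) (hX1 : 1 ≤ X)
    (hF : (2 * h + 1) * (2 * h + 1) * (2 * (f + 1)) ≤ F)
    (hcase : ((ℓ₁ ≤ h + 1 ∨ ℓ₂ ≤ h + 1) ∧ (α ≠ β ∨ ℓ₁ ≠ ℓ₂)) ∨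
      (h + 2 ≤ ℓ₁ ∧ h + 2 ≤ ℓ₂ ∧ j + α = h)) :
    ∃ N, X * N ≤ (h + 1) ^ 4 * Fintype.card V * D ^ (2 * h + 1) ∧
      (ℓ₂ ≤ ℓ₁ → DetBound S ∅ (s '' Set.Iic (2 * h + 1)) N) ∧
      (ℓ₁ ≤ ℓ₂ → DetBound S ∅ (t '' Set.Iic (2 * h + 1)) N) := by
  rcases S.eq_empty_or_nonempty with rfl | ⟨ω₀, h₀⟩
  · exact ⟨0, by simp, fun _ ω hω => absurd hω (by simp), fun _ ω hω => absurd hω (by simp)⟩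
  have hα := (hS ω₀ h₀).lt_left
  have hβ := (hS ω₀ h₀).lt_right
  have hl := (hS ω₀ h₀).le_left
  have hr := (hS ω₀ h₀).le_right
  clear h₀ ω₀
  have hF1 : 1 ≤ F := le_trans (by nlinarith) hF
  have hFD : F ≤ D := le_trans (by
    calc F = 1 * F ^ 1 := by ring
      _ ≤ X * F ^ (h + 1) := Nat.mul_le_mul hX1 (Nat.pow_le_pow_right hF1 (by omega))) hX
  have hZ : ∀ N, N ≤ (h + 1) * (h + 1) * N := fun N =>
    Nat.le_mul_of_pos_left _ (by positivity)
  obtain ⟨a₁, b₁, h₁, n₁⟩ : ∃ a₁ b₁, DetBound S {s (j + α), t (j + β)}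
      ((fun x => s (j + x)) '' Set.Iic α ∪ (fun x => t (j + x)) '' Set.Iic β)
      ((h + 1) * (h + 1) * (D ^ a₁ * F ^ b₁)) ∧
      ((a₁ = min α β ∧ b₁ = max α β - 1 ∧ (j + α = h → 1 ≤ α → β = 0 ∨ h < j + β)) ∨
        (a₁ + 1 = min α β ∧ b₁ = max α β ∧ 1 ≤ β ∧ j + β ≤ h)) := by
    by_cases hc : j + α = h ∧ 1 ≤ α ∧ 1 ≤ β ∧ j + β ≤ h
    · refine ⟨_, _, fork_bound_refined (G := G) (σ := fun x => s (j + x))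
        (τ := fun x => t (j + x)) (fun ω hω => (hS ω hω).fork_base) (by omega) (by omega) hF hFD
        hc.2.1 hc.2.2.1 ?_, Or.inr ⟨by omega, rfl, hc.2.2⟩⟩
      intro ω hω i hi i' hi' he
      exact ⟨(hS ω hω).swap.base_blocked (by omega) (G.bl_symm _ _ he),
        (hS ω hω).base_blocked (by omega) he⟩
    · exact ⟨_, _, (fork_bound (G := G) (σ := fun x => s (j + x)) (τ := fun x => t (j + x))
        (fun ω hω => (hS ω hω).fork_base) (by omega) (by omega) hF).mono_num (hZ _),
        Or.inl ⟨rfl, rfl, by omega⟩⟩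
  have et1 : j + ℓ₁ - (ℓ₁ - 1 - α) = j + α + 1 := by omega
  have et2 : j + ℓ₂ - (ℓ₂ - 1 - β) = j + β + 1 := by omega
  obtain ⟨A, hA⟩ : ∃ A, A = ℓ₁ - 1 - α := ⟨_, rfl⟩
  obtain ⟨B, hB⟩ : ∃ B, B = ℓ₂ - 1 - β := ⟨_, rfl⟩
  rw [← hA] at et1
  rw [← hB] at et2
  obtain ⟨a₂, b₂, h₂, n₂⟩ : ∃ a₂ b₂, DetBound S {s (j + α + 1), t (j + β + 1)}
      ((fun x => s (j + ℓ₁ - x)) '' Set.Iic A ∪ (fun x => t (j + ℓ₂ - x)) '' Set.Iic B)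
      ((h + 1) * (h + 1) * (D ^ a₂ * F ^ b₂)) ∧
      ((a₂ = min A B ∧ b₂ = max A B - 1 ∧ (j + α = h → 1 ≤ A → B = 0 ∨ j + β < h)) ∨
        (a₂ + 1 = min A B ∧ b₂ = max A B ∧ 1 ≤ B ∧ h ≤ j + β)) := by
    by_cases hc : j + α = h ∧ 1 ≤ A ∧ 1 ≤ B ∧ h ≤ j + β
    · have := fork_bound_refined (G := G) (σ := fun x => s (j + ℓ₁ - x))
        (τ := fun x => t (j + ℓ₂ - x)) (A := A) (B := B)
        (fun ω hω => by rw [hA, hB]; exact (hS ω hω).fork_top) (by omega) (by omega) hF hFD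
        hc.2.1 hc.2.2.1 (by
          intro ω hω i hi i' hi' he
          exact ⟨(hS ω hω).swap.top_blocked (by omega) (G.bl_symm _ _ he),
            (hS ω hω).top_blocked (by omega) he⟩)
      rw [et1, et2] at this
      exact ⟨_, _, this, Or.inr ⟨by omega, rfl, hc.2.2⟩⟩
    · have := fork_bound (G := G) (σ := fun x => s (j + ℓ₁ - x))
        (τ := fun x => t (j + ℓ₂ - x)) (A := A) (B := B)
        (fun ω hω => by rw [hA, hB]; exact (hS ω hω).fork_top) (by omega) (by omega) hF
      rw [et1, et2] at this
      exact ⟨_, _, this.mono_num (hZ _), Or.inl ⟨rfl, rfl, by omega⟩⟩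
  have hmain := Meet.assemble hS hα hβ (two_mul_le_of_le hF) h₁ (hA ▸ hB ▸ h₂)
  have hexp : (1 + a₁ + a₂ + 1 ≤ max ℓ₁ ℓ₂ ∧ 1 + a₁ + a₂ + (1 + b₁ + b₂) ≤ h + max ℓ₁ ℓ₂) ∨
      (1 + a₁ + a₂ + 2 ≤ max ℓ₁ ℓ₂ ∧ 1 + a₁ + a₂ + (1 + b₁ + b₂) ≤ 2 * h + max ℓ₁ ℓ₂) := by
    have eA : A + 1 + α = ℓ₁ := by clear n₁ n₂; omega
    have eB : B + 1 + β = ℓ₂ := by clear n₁ n₂; omega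
    rcases hcase with hc | ⟨hc1, hc2, hc3⟩
    · exact Or.inl (exponents_of_short hc hα hβ hr eA eB
        (n₁.imp (fun x => ⟨x.1, x.2.1⟩) fun x => ⟨x.1, x.2.1⟩)
        (n₂.imp (fun x => ⟨x.1, x.2.1⟩) fun x => ⟨x.1, x.2.1⟩))
    · have hα1 : 1 ≤ α := by clear n₁ n₂; omega
      have hA1 : 1 ≤ A := by clear n₁ n₂; omega
      exact exponents_of_long hc1 hc2 hc3 hα hβ hl hr eA eB
        (n₁.imp_left fun x => ⟨x.1, x.2.1, x.2.2 hc3 hα1⟩)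
        (n₂.imp_left fun x => ⟨x.1, x.2.1, x.2.2 hc3 hA1⟩)
  have hnum := mul_pow_mul_pow_le hX hX1 hF1 hexp
  refine ⟨Fintype.card V * D * F * ((h + 1) * (h + 1) * (D ^ a₁ * F ^ b₁)) *
    ((h + 1) * (h + 1) * (D ^ a₂ * F ^ b₂)) * D ^ (2 * h + 1 - max ℓ₁ ℓ₂), ?_, ?_, ?_⟩
  · calc _ = (h + 1) ^ 4 * Fintype.card V *
          (X * (D ^ (1 + a₁ + a₂) * F ^ (1 + b₁ + b₂))) * D ^ (2 * h + 1 - max ℓ₁ ℓ₂) := by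
          rw [pow_add, pow_add, pow_add, pow_add]; ring
      _ ≤ (h + 1) ^ 4 * Fintype.card V * D ^ max ℓ₁ ℓ₂ * D ^ (2 * h + 1 - max ℓ₁ ℓ₂) := by
          gcongr
      _ = _ := by
          rw [mul_assoc, ← pow_add]
          congr 2
          omega
  · intro hle
    refine hmain.trans (I' := s '' Set.Icc j (j + ℓ₁)) (K := s '' Set.Iic (2 * h + 1)) ?_
      (by rw [Set.empty_union]; exact Set.subset_union_left) Set.subset_union_right
    have := tail_bound (G := G) (S := S) (s := s) (k := 2 * h + 1) (j := j) (m := j + ℓ₁)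
      (fun ω hω => (hS ω hω).good_left.unb.1) (by omega) hl
    rwa [show j + ℓ₁ - j = max ℓ₁ ℓ₂ by omega] at this
  · intro hle
    refine hmain.trans (I' := t '' Set.Icc j (j + ℓ₂)) (K := t '' Set.Iic (2 * h + 1)) ?_
      (by rw [Set.empty_union]; exact Set.subset_union_right) Set.subset_union_right
    have := tail_bound (G := G) (S := S) (s := t) (k := 2 * h + 1) (j := j) (m := j + ℓ₂)
      (fun ω hω => (hS ω hω).good_right.unb.1) (by omega) hr
    rwa [show j + ℓ₂ - j = max ℓ₁ ℓ₂ by omega] at this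

theorem Meet.bound [Fintype V] {S : Set (ι → V)} {s t : ℕ → ι} {X : ℕ}
    (hS : ∀ ω ∈ S, G.Meet (ω ∘ s) (ω ∘ t) j ℓ₁ ℓ₂ α β) (hX : X * F ^ (h + 1) ≤ D) (hX1 : 1 ≤ X)
    (hF : (2 * h + 1) * (2 * h + 1) * (2 * (f + 1)) ≤ F)
    (hcase : ((ℓ₁ ≤ h + 1 ∨ ℓ₂ ≤ h + 1) ∧ (α ≠ β ∨ ℓ₁ ≠ ℓ₂)) ∨
      (h + 2 ≤ ℓ₁ ∧ h + 2 ≤ ℓ₂ ∧ (j + α = h ∨ j + β = h))) :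
    ∃ N, X * N ≤ (h + 1) ^ 4 * Fintype.card V * D ^ (2 * h + 1) ∧
      (ℓ₂ ≤ ℓ₁ → DetBound S ∅ (s '' Set.Iic (2 * h + 1)) N) ∧
      (ℓ₁ ≤ ℓ₂ → DetBound S ∅ (t '' Set.Iic (2 * h + 1)) N) := by
  rcases hcase with hc | ⟨h1, h2, hc | hc⟩
  · exact Meet.bound_aux hS hX hX1 hF (Or.inl hc)
  · exact Meet.bound_aux hS hX hX1 hF (Or.inr ⟨h1, h2, hc⟩)
  · obtain ⟨N, hN, h3, h4⟩ := Meet.bound_aux (fun ω hω => (hS ω hω).swap) hX hX1 hF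
      (Or.inr ⟨h2, h1, hc⟩)
    exact ⟨N, hN, h4, h3⟩

end BlockedGraph

namespace BlockedGraph

variable {V ι : Type} {h f D F : ℕ} {G : BlockedGraph V h f D} {p q ω : ℕ → V}
  {j ℓ₁ ℓ₂ α β : ℕ}

/-- Two good paths that share their vertex `j`, separate, and meet again after `ℓ₁` and `ℓ₂` steps
respectively. -/
structure Bigon (G : BlockedGraph V h f D) (p q : ℕ → V) (j ℓ₁ ℓ₂ : ℕ) : Prop where
  good_left : G.Good p
  good_right : G.Good q
  le_left : j + ℓ₁ ≤ 2 * h + 1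
  le_right : j + ℓ₂ ≤ 2 * h + 1
  base : p j = q j
  ne : p (j + 1) ≠ q (j + 1)
  top : p (j + ℓ₁) = q (j + ℓ₂)
  disj : ∀ i ≤ ℓ₁, ∀ i' ≤ ℓ₂, p (j + i) = q (j + i') → (i = 0 ∧ i' = 0) ∨ (i = ℓ₁ ∧ i' = ℓ₂)
  pos_left : 0 < ℓ₁
  pos_right : 0 < ℓ₂

theorem Bigon.swap (hb : G.Bigon p q j ℓ₁ ℓ₂) : G.Bigon q p j ℓ₂ ℓ₁ :=
  ⟨hb.good_right, hb.good_left, hb.le_right, hb.le_left, hb.base.symm, hb.ne.symm, hb.top.symm,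
    fun i hi i' hi' he => (hb.disj i' hi' i hi he.symm).imp And.symm And.symm,
    hb.pos_right, hb.pos_left⟩

theorem Bigon.meet (hb : G.Bigon p q j ℓ₁ ℓ₂) (hα : α < ℓ₁) (hβ : β < ℓ₂)
    (hbl : stepEdge q (j + β) ∈ G.bl (stepEdge p (j + α))) : G.Meet p q j ℓ₁ ℓ₂ α β :=
  ⟨hb.good_left, hb.good_right, hb.le_left, hb.le_right, hb.base, hb.top, hb.disj, hα, hβ, hbl⟩

theorem exists_bigon (hp : G.Good p) (hq : G.Good q) (h0 : p 0 = q 0)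
    (h1 : p (2 * h + 1) = q (2 * h + 1)) (hne : ∃ i ≤ 2 * h + 1, p i ≠ q i) :
    ∃ j ℓ₁ ℓ₂, G.Bigon p q j ℓ₁ ℓ₂ := by
  classical
  obtain ⟨i₀, hi₀, hmin⟩ : ∃ i, (i ≤ 2 * h + 1 ∧ p i ≠ q i) ∧ ∀ i' < i, p i' = q i' := by
    refine ⟨Nat.find hne, Nat.find_spec hne, fun i' hi' => ?_⟩
    by_contra h2
    exact Nat.find_min hne hi' ⟨hi'.le.trans (Nat.find_spec hne).1, h2⟩
  have hpos : i₀ ≠ 0 := by rintro rfl; exact hi₀.2 h0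
  have hlast : i₀ ≠ 2 * h + 1 := by rintro rfl; exact hi₀.2 h1
  obtain ⟨j, rfl⟩ := Nat.exists_eq_succ_of_ne_zero hpos
  simp only [Nat.succ_eq_add_one] at *
  have hex : ∃ ℓ₂, 1 ≤ ℓ₂ ∧ j + ℓ₂ ≤ 2 * h + 1 ∧
      ∃ ℓ₁, 1 ≤ ℓ₁ ∧ j + ℓ₁ ≤ 2 * h + 1 ∧ p (j + ℓ₁) = q (j + ℓ₂) :=
    ⟨2 * h + 1 - j, by omega, by omega, 2 * h + 1 - j, by omega, by omega, by
      rwa [show j + (2 * h + 1 - j) = 2 * h + 1 by omega]⟩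
  obtain ⟨h2, h3, ℓ₁, h4, h5, h6⟩ := Nat.find_spec hex
  have hmin2 : ∀ m, 1 ≤ m → j + m ≤ 2 * h + 1 → (∃ ℓ₁, 1 ≤ ℓ₁ ∧ j + ℓ₁ ≤ 2 * h + 1 ∧
      p (j + ℓ₁) = q (j + m)) → Nat.find hex ≤ m :=
    fun m a b c => Nat.find_min' hex ⟨a, b, c⟩
  generalize Nat.find hex = ℓ₂ at *
  have hbase := hmin j (by omega)
  refine ⟨j, ℓ₁, ℓ₂, hp, hq, h5, h3, hbase, hi₀.2, h6, ?_, h4, h2⟩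
  intro i hi i' hi' he
  rcases Nat.eq_zero_or_pos i' with rfl | hi0'
  · rw [Nat.add_zero, ← hbase] at he
    have := hp.unb.1.2 _ (by omega) _ (by omega) he
    omega
  rcases Nat.eq_zero_or_pos i with rfl | hi0
  · rw [Nat.add_zero, hbase] at he
    have := hq.unb.1.2 _ (by omega) _ (by omega) he
    omega
  have h7 := hmin2 i' hi0' (by omega) ⟨i, hi0, by omega, he⟩
  obtain rfl : i' = ℓ₂ := by omega
  rw [← h6] at he
  have := hp.unb.1.2 _ (by omega) _ (by omega) he
  omega

theorem Bigon.exists_blocked (hb : G.Bigon p q j ℓ₁ ℓ₂) (hα : α < ℓ₁)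
    (hmp : ∀ i < ℓ₁, G.rank (stepEdge p (j + i)) ≤ G.rank (stepEdge p (j + α)))
    (hmq : ∀ i < ℓ₂, G.rank (stepEdge q (j + i)) ≤ G.rank (stepEdge p (j + α))) :
    ∃ β, G.Meet p q j ℓ₁ ℓ₂ α β ∧ (ℓ₁ + ℓ₂ ≤ 2 * h + 2 → α ≠ β) := by
  have l1 := hb.le_left
  have l2 := hb.le_right
  obtain ⟨b, hb1, hb2, hb3⟩ := (hb.good_left.unb.window l1).exists_blocked
    (hb.good_right.unb.1.window l2) hb.base hb.top (by
      intro i hi i' hi' he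
      rcases Sym2.eq_iff.1 he with ⟨h1, h2⟩ | ⟨h1, h2⟩
      · have := hb.disj _ hi.le _ hi'.le h1
        obtain ⟨rfl, rfl⟩ : i = 0 ∧ i' = 0 := by omega
        exact hb.ne h2
      · have := hb.disj _ hi.le _ hi' h1
        omega) (by omega) hα hmp hmq
  by_cases hc : ℓ₁ + ℓ₂ ≤ 2 * h + 2
  · obtain ⟨b', hb1', hne, hb2'⟩ := hb3 hc
    by_cases hαb : α = b
    · exact ⟨b', hb.meet hα hb1' hb2', fun _ => by omega⟩
    · exact ⟨b, hb.meet hα hb1 hb2, fun _ => hαb⟩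
  · exact ⟨b, hb.meet hα hb1 hb2, fun h => absurd h hc⟩

/-- The position data of a meet to which `Meet.bound` applies. -/
def Admissible (h j ℓ₁ ℓ₂ α β : ℕ) : Prop :=
  ((ℓ₁ ≤ h + 1 ∨ ℓ₂ ≤ h + 1) ∧ (α ≠ β ∨ ℓ₁ ≠ ℓ₂)) ∨
    (h + 2 ≤ ℓ₁ ∧ h + 2 ≤ ℓ₂ ∧ (j + α = h ∨ j + β = h))

theorem Bigon.exists_meet (hb : G.Bigon p q j ℓ₁ ℓ₂) :
    ∃ α β, G.Meet p q j ℓ₁ ℓ₂ α β ∧ Admissible h j ℓ₁ ℓ₂ α β := by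
  have l1 := hb.le_left
  have l2 := hb.le_right
  by_cases hlong : h + 2 ≤ ℓ₁ ∧ h + 2 ≤ ℓ₂
  · obtain ⟨μ, rfl⟩ : ∃ μ, h = j + μ := ⟨h - j, by omega⟩
    have m1 := fun i (hi : i < ℓ₁) => hb.good_left.rank_le (j + i) (by omega)
    have m2 := fun i (hi : i < ℓ₂) => hb.good_right.rank_le (j + i) (by omega)
    rcases le_total (G.rank (stepEdge q (j + μ))) (G.rank (stepEdge p (j + μ))) with hle | hle
    · obtain ⟨β, hβ, -⟩ := hb.exists_blocked (α := μ) (by omega) m1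
        fun i hi => (m2 i hi).trans hle
      exact ⟨μ, β, hβ, Or.inr ⟨hlong.1, hlong.2, Or.inl rfl⟩⟩
    · obtain ⟨β, hβ, -⟩ := hb.swap.exists_blocked (α := μ) (by omega) m2
        fun i hi => (m1 i hi).trans hle
      exact ⟨β, μ, hβ.swap, Or.inr ⟨hlong.1, hlong.2, Or.inr rfl⟩⟩
  · obtain ⟨a, ha, hmp⟩ := exists_max_rank G.rank (fun i => p (j + i)) hb.pos_left
    obtain ⟨b, hb', hmq⟩ := exists_max_rank G.rank (fun i => q (j + i)) hb.pos_right
    rcases le_total (G.rank (stepEdge q (j + b))) (G.rank (stepEdge p (j + a))) with hle | hle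
    · obtain ⟨β, hβ, hne⟩ := hb.exists_blocked ha hmp fun i hi => (hmq i hi).trans hle
      exact ⟨a, β, hβ, Or.inl ⟨by omega, by omega⟩⟩
    · obtain ⟨β, hβ, hne⟩ := hb.swap.exists_blocked hb' hmq fun i hi => (hmp i hi).trans hle
      exact ⟨β, b, hβ.swap, Or.inl ⟨by omega, by omega⟩⟩

/-- A family of good paths has few members beyond one for each pair of endpoints. -/
theorem card_good_le [Fintype V] {X : ℕ} (P : Finset (ℕ → V)) (hP : ∀ p ∈ P, G.Good p)
    (hinj : ∀ p ∈ P, ∀ q ∈ P, Set.EqOn p q (Set.Iic (2 * h + 1)) → p = q)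
    (hX : X * F ^ (h + 1) ≤ D) (hX1 : 1 ≤ X)
    (hF : (2 * h + 1) * (2 * h + 1) * (2 * (f + 1)) ≤ F) :
    X * P.card ≤ X * (Fintype.card V * Fintype.card V) +
      (2 * h + 2) ^ 5 * (2 * ((h + 1) ^ 4 * Fintype.card V * D ^ (2 * h + 1))) := by
  classical
  let r := Finset.range (2 * h + 2)
  let T := r ×ˢ r ×ˢ r ×ˢ r ×ˢ r
  let B₁ : ℕ × ℕ × ℕ × ℕ × ℕ → Finset (ℕ → V) := fun c => P.filter fun p => ∃ q,
    G.Meet p q c.1 c.2.1 c.2.2.1 c.2.2.2.1 c.2.2.2.2 ∧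
      Admissible h c.1 c.2.1 c.2.2.1 c.2.2.2.1 c.2.2.2.2 ∧ c.2.2.1 ≤ c.2.1
  let B₂ : ℕ × ℕ × ℕ × ℕ × ℕ → Finset (ℕ → V) := fun c => P.filter fun q => ∃ p,
    G.Meet p q c.1 c.2.1 c.2.2.1 c.2.2.2.1 c.2.2.2.2 ∧
      Admissible h c.1 c.2.1 c.2.2.1 c.2.2.2.1 c.2.2.2.2 ∧ c.2.1 ≤ c.2.2.1
  let B := T.biUnion fun c => B₁ c ∪ B₂ c
  have hB₁ : ∀ c, X * (B₁ c).card ≤ (h + 1) ^ 4 * Fintype.card V * D ^ (2 * h + 1) := by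
    intro c
    by_cases hc : Admissible h c.1 c.2.1 c.2.2.1 c.2.2.2.1 c.2.2.2.2 ∧ c.2.2.1 ≤ c.2.1
    swap
    · have : B₁ c = ∅ := Finset.filter_eq_empty_iff.2 fun p _ ⟨q, _, h2⟩ => hc h2
      simp [this]
    obtain ⟨N, hN, h1, -⟩ := Meet.bound (ι := Bool × ℕ) (s := fun i => (false, i))
      (t := fun i => (true, i)) (S := {ω | G.Meet (fun i => ω (false, i)) (fun i => ω (true, i))
        c.1 c.2.1 c.2.2.1 c.2.2.2.1 c.2.2.2.2}) (fun ω hω => hω) hX hX1 hF hc.1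
    refine (Nat.mul_le_mul_left _ ?_).trans hN
    have hex : ∀ p ∈ B₁ c, ∃ q, G.Meet p q c.1 c.2.1 c.2.2.1 c.2.2.2.1 c.2.2.2.2 :=
      fun p hp => (Finset.mem_filter.1 hp).2.imp fun q hq => hq.1
    choose! φ hφ using hex
    refine DetBound.card_le (B₁ c) (fun p x => if x.1 then φ p x.2 else p x.2) (fun p hp => ?_)
      (h1 hc.2) fun p hp q hq he => hinj p (Finset.mem_filter.1 hp).1 q (Finset.mem_filter.1 hq).1
        fun i hi => ?_
    · simpa using hφ p hp
    · simpa using he ⟨i, hi, rfl⟩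
  have hB₂ : ∀ c, X * (B₂ c).card ≤ (h + 1) ^ 4 * Fintype.card V * D ^ (2 * h + 1) := by
    intro c
    by_cases hc : Admissible h c.1 c.2.1 c.2.2.1 c.2.2.2.1 c.2.2.2.2 ∧ c.2.1 ≤ c.2.2.1
    swap
    · have : B₂ c = ∅ := Finset.filter_eq_empty_iff.2 fun p _ ⟨q, _, h2⟩ => hc h2
      simp [this]
    obtain ⟨N, hN, -, h1⟩ := Meet.bound (ι := Bool × ℕ) (s := fun i => (false, i))
      (t := fun i => (true, i)) (S := {ω | G.Meet (fun i => ω (false, i)) (fun i => ω (true, i))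
        c.1 c.2.1 c.2.2.1 c.2.2.2.1 c.2.2.2.2}) (fun ω hω => hω) hX hX1 hF hc.1
    refine (Nat.mul_le_mul_left _ ?_).trans hN
    have hex : ∀ q ∈ B₂ c, ∃ p, G.Meet p q c.1 c.2.1 c.2.2.1 c.2.2.2.1 c.2.2.2.2 :=
      fun p hp => (Finset.mem_filter.1 hp).2.imp fun q hq => hq.1
    choose! φ hφ using hex
    refine DetBound.card_le (B₂ c) (fun q x => if x.1 then q x.2 else φ q x.2) (fun p hp => ?_)
      (h1 hc.2) fun p hp q hq he => hinj p (Finset.mem_filter.1 hp).1 q (Finset.mem_filter.1 hq).1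
        fun i hi => ?_
    · simpa using hφ p hp
    · simpa using he ⟨i, hi, rfl⟩
  have hT : T.card = (2 * h + 2) ^ 5 := by
    simp only [T, r, Finset.card_product, Finset.card_range]; ring
  have hBcard : X * B.card ≤
      (2 * h + 2) ^ 5 * (2 * ((h + 1) ^ 4 * Fintype.card V * D ^ (2 * h + 1))) := by
    calc X * B.card ≤ X * ∑ c ∈ T, (B₁ c ∪ B₂ c).card :=
          Nat.mul_le_mul_left _ Finset.card_biUnion_le
      _ = ∑ c ∈ T, X * (B₁ c ∪ B₂ c).card := Finset.mul_sum _ _ _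
      _ ≤ ∑ c ∈ T, 2 * ((h + 1) ^ 4 * Fintype.card V * D ^ (2 * h + 1)) := by
          refine Finset.sum_le_sum fun c _ => ?_
          have h1 := Nat.mul_le_mul_left X (Finset.card_union_le (B₁ c) (B₂ c))
          have h2 := hB₁ c
          have h3 := hB₂ c
          rw [mul_add] at h1
          omega
      _ = _ := by rw [Finset.sum_const, hT, smul_eq_mul]
  have hrest : (P \ B).card ≤ Fintype.card V * Fintype.card V := by
    rw [← Fintype.card_prod]
    refine Finset.card_le_card_of_injOn (fun p => (p 0, p (2 * h + 1)))
      (fun _ _ => Finset.mem_univ _) fun p hp q hq he => ?_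
    have hp' := Finset.mem_sdiff.1 hp
    have hq' := Finset.mem_sdiff.1 hq
    rw [Prod.mk.injEq] at he
    by_contra hne
    obtain ⟨j, ℓ₁, ℓ₂, hb⟩ := exists_bigon (hP p hp'.1) (hP q hq'.1) he.1 he.2 (by
      by_contra hx
      push Not at hx
      exact hne (hinj p hp'.1 q hq'.1 fun i hi => hx i hi))
    obtain ⟨α, β, hm, ha⟩ := hb.exists_meet
    have hc : (j, ℓ₁, ℓ₂, α, β) ∈ T := by
      have := hm.le_left
      have := hm.le_right
      have := hm.lt_left
      have := hm.lt_right
      simp only [T, r, Finset.mem_product, Finset.mem_range]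
      omega
    rcases le_total ℓ₂ ℓ₁ with hle | hle
    · exact hp'.2 (Finset.mem_biUnion.2 ⟨_, hc, Finset.mem_union_left _
        (Finset.mem_filter.2 ⟨hp'.1, q, hm, ha, hle⟩)⟩)
    · exact hq'.2 (Finset.mem_biUnion.2 ⟨_, hc, Finset.mem_union_right _
        (Finset.mem_filter.2 ⟨hq'.1, p, hm, ha, hle⟩)⟩)
  calc X * P.card ≤ X * ((P \ B).card + B.card) :=
        Nat.mul_le_mul_left _ (by
          have := Finset.card_le_card_sdiff_add_card (s := P) (t := B)
          exact this)
    _ ≤ _ := by rw [mul_add]; exact Nat.add_le_add (Nat.mul_le_mul_left _ hrest) hBcard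

end BlockedGraph

/-- A dense symmetric relation is dense around each point of some nonempty set. -/
theorem exists_dense_subset {V : Type} [Fintype V] [DecidableEq V] (R : Finset (V × V))
    (hR : ∀ u v, (u, v) ∈ R → (v, u) ∈ R) {t : ℕ} (ht : 2 * t * Fintype.card V < R.card) :
    ∃ S : Finset V, S.Nonempty ∧ ∀ u ∈ S, t < (S.filter fun v => (u, v) ∈ R).card := by
  let r : Finset V → ℕ := fun S => (R.filter fun x => x.1 ∈ S ∧ x.2 ∈ S).card
  have huniv : (Finset.univ.filter fun S : Finset V => 2 * t * S.card < r S).Nonempty :=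
    ⟨Finset.univ, by simpa [r] using ht⟩
  obtain ⟨S, hS, hmin⟩ := Finset.exists_min_image _ Finset.card huniv
  rw [Finset.mem_filter] at hS
  refine ⟨S, Finset.nonempty_iff_ne_empty.2 fun h => by simp [r, h] at hS, fun u hu => ?_⟩
  by_contra! hle
  have hcard := Finset.card_erase_add_one hu
  have hsub : (R.filter fun x => x.1 ∈ S ∧ x.2 ∈ S) ⊆
      (R.filter fun x => x.1 ∈ S.erase u ∧ x.2 ∈ S.erase u) ∪
        ((S.filter fun v => (u, v) ∈ R).image (fun v => (u, v)) ∪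
          (S.filter fun v => (u, v) ∈ R).image (fun v => (v, u))) := by
    rintro ⟨a, b⟩ hab
    simp only [Finset.mem_filter] at hab
    simp only [Finset.mem_union, Finset.mem_filter, Finset.mem_erase, Finset.mem_image,
      Prod.mk.injEq]
    by_cases ha : a = u
    · exact Or.inr (Or.inl ⟨b, ⟨hab.2.2, ha ▸ hab.1⟩, ha.symm, rfl⟩)
    · by_cases hb : b = u
      · exact Or.inr (Or.inr ⟨a, ⟨hab.2.1, hb ▸ hR _ _ hab.1⟩, rfl, hb.symm⟩)
      · exact Or.inl ⟨hab.1, ⟨ha, hab.2.1⟩, hb, hab.2.2⟩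
  have h1 := Finset.card_le_card hsub
  have h2 := Finset.card_union_le (R.filter fun x => x.1 ∈ S.erase u ∧ x.2 ∈ S.erase u)
    ((S.filter fun v => (u, v) ∈ R).image (fun v => (u, v)) ∪
      (S.filter fun v => (u, v) ∈ R).image (fun v => (v, u)))
  have h3 := Finset.card_union_le ((S.filter fun v => (u, v) ∈ R).image (fun v => (u, v)))
    ((S.filter fun v => (u, v) ∈ R).image (fun v => (v, u)))
  have h4 := Finset.card_image_le (s := S.filter fun v => (u, v) ∈ R) (f := fun v => (u, v))
  have h5 := Finset.card_image_le (s := S.filter fun v => (u, v) ∈ R) (f := fun v => (v, u))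
  have h6 : 2 * t * S.card < r S := hS.2
  have h7 : r S ≤ r (S.erase u) + 2 * t := by simp only [r]; omega
  have h8 : 2 * t * (S.erase u).card < r (S.erase u) := by
    rw [← hcard, mul_add] at h6; omega
  have := hmin _ (Finset.mem_filter.2 ⟨Finset.mem_univ _, h8⟩)
  omega

/-- Extending every member of a family of sequences by one further term in at least `d` ways. -/
theorem exists_update_family {V : Type} [DecidableEq V] (Z : Finset (ℕ → V)) {m d : ℕ}
    (hZ : ∀ z ∈ Z, z (m + 1) = z 0) (Q : (ℕ → V) → Prop)
    (hQ : ∀ z ∈ Z, ∃ N : Finset V, d ≤ N.card ∧ ∀ x ∈ N, Q (Function.update z (m + 1) x)) :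
    ∃ Z' : Finset (ℕ → V), d * Z.card ≤ Z'.card ∧ ∀ z ∈ Z', Q z := by
  classical
  choose! N hN hNQ using hQ
  refine ⟨(Z.sigma N).image fun zx => Function.update zx.1 (m + 1) zx.2, ?_, ?_⟩
  · rw [Finset.card_image_of_injOn, Finset.card_sigma, mul_comm, ← smul_eq_mul]
    · exact Finset.card_nsmul_le_sum _ _ _ hN
    · rintro ⟨z, x⟩ hz ⟨z', x'⟩ hz' he
      have hz := (Finset.mem_sigma.1 hz).1
      have hz' := (Finset.mem_sigma.1 hz').1
      have hx : x = x' := by simpa using congrFun he (m + 1)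
      have heq : ∀ i, i ≠ m + 1 → z i = z' i := fun i hi => by
        simpa [hi] using congrFun he i
      have hzz : z = z' := by
        funext i
        by_cases hi : i = m + 1
        · rw [hi, hZ z hz, hZ z' hz', heq 0 (by omega)]
        · exact heq i hi
      rw [hx, hzz]
  · simp only [Finset.mem_image, Finset.mem_sigma]
    rintro _ ⟨zx, ⟨h1, h2⟩, rfl⟩
    exact hNQ _ h1 _ h2

namespace BlockedGraph

variable {V : Type} {h f D F : ℕ} (G : BlockedGraph V h f D)

/-- The set `S` witnesses that the edge `uv` survives when vertices of degree at most `t` are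
repeatedly deleted from the graph of edges of rank at most that of `uv`. -/
def IsCore (t : ℕ) (u v : V) (S : Finset V) : Prop :=
  u ∈ S ∧ v ∈ S ∧ ∀ x ∈ S, ∃ N ⊆ S, t < N.card ∧
    ∀ y ∈ N, G.graph.Adj x y ∧ G.rank s(x, y) ≤ G.rank s(u, v)

variable {G}

theorem IsCore.swap {t : ℕ} {u v : V} {S : Finset V} (hS : G.IsCore t u v S) :
    G.IsCore t v u S :=
  ⟨hS.2.1, hS.1, by rw [Sym2.eq_swap (a := v)]; exact hS.2.2⟩

variable (G) in
theorem exists_coreDarts [Fintype V] (t : ℕ) : ∃ C : Finset (V × V),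
    (∀ x ∈ C, G.graph.Adj x.1 x.2 ∧ ∃ S, G.IsCore t x.1 x.2 S) ∧
    ∑ u, (G.nbrs u).card ≤ C.card + 2 * t * Fintype.card V := by
  classical
  let A : Finset (V × V) := Finset.univ.filter fun x => G.graph.Adj x.1 x.2
  have hA : ∑ u, (G.nbrs u).card = A.card := by
    rw [← Finset.card_sigma]
    refine Finset.card_bij (fun x _ => (x.1, x.2)) ?_ ?_ ?_
    · rintro ⟨u, v⟩ hx
      simpa [A, G.mem_nbrs] using hx
    · rintro ⟨u, v⟩ - ⟨u', v'⟩ - he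
      simpa using he
    · rintro ⟨u, v⟩ hx
      exact ⟨⟨u, v⟩, by simpa [A, G.mem_nbrs] using hx, rfl⟩
  refine ⟨A.filter fun x => ∃ S, G.IsCore t x.1 x.2 S, fun x hx => ?_, ?_⟩
  · simpa [A] using hx
  · rw [hA, ← Finset.card_filter_add_card_filter_not (s := A)
      (fun x => ∃ S, G.IsCore t x.1 x.2 S)]
    refine Nat.add_le_add_left ?_ _
    refine le_of_not_gt fun hlt => ?_
    obtain ⟨S, ⟨s, hs⟩, hS⟩ := exists_dense_subset
      (A.filter fun x => ¬ ∃ S, G.IsCore t x.1 x.2 S) (fun u v huv => by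
        simp only [A, Finset.mem_filter, Finset.mem_univ, true_and] at huv ⊢
        exact ⟨huv.1.symm, fun ⟨S, hS⟩ => huv.2 ⟨S, hS.swap⟩⟩) hlt
    set R := A.filter fun x => ¬ ∃ S, G.IsCore t x.1 x.2 S with hR
    obtain ⟨v, hv⟩ := Finset.card_pos.1 ((Nat.zero_le t).trans_lt (hS s hs))
    rw [Finset.mem_filter] at hv
    obtain ⟨⟨a, b⟩, hab, hmax⟩ := Finset.exists_max_image
      (R.filter fun x => x.1 ∈ S ∧ x.2 ∈ S) (fun x => G.rank s(x.1, x.2))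
      ⟨(s, v), Finset.mem_filter.2 ⟨hv.2, hs, hv.1⟩⟩
    rw [Finset.mem_filter] at hab
    have hab' := hab.1
    rw [hR, Finset.mem_filter] at hab'
    refine hab'.2 ⟨S, hab.2.1, hab.2.2, fun x hx =>
      ⟨_, Finset.filter_subset _ _, hS x hx, fun y hy => ?_⟩⟩
    rw [Finset.mem_filter] at hy
    refine ⟨?_, hmax (x, y) (Finset.mem_filter.2 ⟨hy.2, hx, hy.1⟩)⟩
    have := hy.2
    simp only [hR, A, Finset.mem_filter, Finset.mem_univ, true_and] at this
    exact this.1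

/-- The index of the vertex to which the vertex `τ` is attached when a path with `2h+1` edges is
built from its middle edge, first in one direction and then in the other. -/
def par (h τ : ℕ) : ℕ := if τ = h + 2 then 0 else τ - 1

theorem par_lt {τ : ℕ} (hτ : 1 ≤ τ) : par h τ < τ := by
  unfold par; split_ifs <;> omega

/-- The first `m + 1` vertices of a good path built from its middle edge, inside `S`. -/
structure Grow (G : BlockedGraph V h f D) (S : V × V → Finset V) (z : ℕ → V) (m : ℕ) : Prop where
  mem : ∀ i ≤ m, z i ∈ S (z 0, z 1)
  inj : ∀ i ≤ m, ∀ j ≤ m, z i = z j → i = j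
  adj : ∀ τ, 1 ≤ τ → τ ≤ m → G.graph.Adj (z (par h τ)) (z τ)
  rank : ∀ τ, 1 ≤ τ → τ ≤ m → G.rank s(z (par h τ), z τ) ≤ G.rank s(z 0, z 1)
  free : ∀ σ τ, 1 ≤ σ → σ < τ → τ ≤ m → ∀ e ∈ G.bl s(z (par h σ), z σ), z τ ∉ e
  default : ∀ i, m < i → z i = z 0

theorem Grow.exists_extend {S : V × V → Finset V} {z : ℕ → V} {m d : ℕ} (hz : G.Grow S z m)
    (hm : 1 ≤ m) (hmh : m ≤ 2 * h) (hS : G.IsCore (2 * d) (z 0) (z 1) (S (z 0, z 1)))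
    (hd : 2 * h + 2 + 2 * f * (2 * h + 1) ≤ d) :
    ∃ N : Finset V, d ≤ N.card ∧ ∀ x ∈ N, G.Grow S (Function.update z (m + 1) x) (m + 1) := by
  classical
  have hpar : par h (m + 1) ≤ m := Nat.lt_succ_iff.1 (par_lt (by omega))
  obtain ⟨N, hNS, hN, hNa⟩ := hS.2.2 _ (hz.mem _ hpar)
  let B : Finset V := (Finset.Icc 1 m).biUnion fun σ =>
    (G.bl s(z (par h σ), z σ)).biUnion fun e => e.toFinset
  have hB : B.card ≤ m * (f * 2) := by
    refine (Finset.card_biUnion_le_card_mul _ _ (f * 2) fun σ _ =>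
      (Finset.card_biUnion_le_card_mul _ _ 2 fun e _ => ?_).trans
        (Nat.mul_le_mul_right _ (G.card_bl _))).trans (by simp)
    rw [Sym2.card_toFinset]
    split_ifs <;> omega
  refine ⟨(N \ (Finset.range (m + 1)).image z) \ B, ?_, fun x hx => ?_⟩
  · have h1 := Finset.card_le_card_sdiff_add_card (s := N) (t := (Finset.range (m + 1)).image z)
    have h2 := Finset.card_le_card_sdiff_add_card
      (s := N \ (Finset.range (m + 1)).image z) (t := B)
    have h3 : ((Finset.range (m + 1)).image z).card ≤ m + 1 :=
      Finset.card_image_le.trans (by simp)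
    have h4 : m * (f * 2) ≤ 2 * f * (2 * h + 1) := by
      rw [mul_comm, mul_comm f]; exact Nat.mul_le_mul_left _ (by omega)
    omega
  · simp only [Finset.mem_sdiff, Finset.mem_image, Finset.mem_range, B, Finset.mem_biUnion,
      Finset.mem_Icc, Sym2.mem_toFinset, not_exists, not_and] at hx
    obtain ⟨⟨hxN, hxz⟩, hxB⟩ := hx
    have hu : ∀ i, i ≤ m → Function.update z (m + 1) x i = z i := fun i hi =>
      Function.update_of_ne (by omega) _ _
    have hp : ∀ τ, 1 ≤ τ → τ ≤ m + 1 → par h τ ≤ m := fun τ h1 h2 => by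
      have := par_lt (h := h) h1; omega
    have hlast : Function.update z (m + 1) x (m + 1) = x := Function.update_self _ _ _
    have hcase : ∀ τ, τ ≤ m + 1 → τ ≤ m ∨ τ = m + 1 := fun τ _ => by omega
    refine ⟨fun i hi => ?_, fun i hi j hj he => ?_, fun τ h1 h2 => ?_, fun τ h1 h2 => ?_,
      fun σ τ h1 h2 h3 => ?_, fun i hi => ?_⟩
    · rw [hu 0 (by omega), hu 1 hm]
      rcases hcase i hi with hi | rfl
      · rw [hu i hi]; exact hz.mem i hi
      · rw [hlast]; exact hNS hxN
    · rcases hcase i hi with hi | rfl <;> rcases hcase j hj with hj | rfl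
      · rw [hu i hi, hu j hj] at he; exact hz.inj i hi j hj he
      · rw [hu i hi, hlast] at he; exact absurd he (hxz i (by omega))
      · rw [hu j hj, hlast] at he; exact absurd he.symm (hxz j (by omega))
      · rfl
    · rw [hu _ (hp τ h1 h2)]
      rcases hcase τ h2 with h2 | rfl
      · rw [hu τ h2]; exact hz.adj τ h1 h2
      · rw [hlast]; exact (hNa x hxN).1
    · rw [hu _ (hp τ h1 h2), hu 0 (by omega), hu 1 hm]
      rcases hcase τ h2 with h2 | rfl
      · rw [hu τ h2]; exact hz.rank τ h1 h2
      · rw [hlast]; exact (hNa x hxN).2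
    · rw [hu _ (hp σ h1 (by omega)), hu σ (by omega)]
      rcases hcase τ h3 with h3 | rfl
      · rw [hu τ h3]; exact hz.free σ τ h1 h2 h3
      · rw [hlast]; exact fun e he hxe => hxB σ ⟨h1, by omega⟩ e he hxe
    · rw [Function.update_of_ne (by omega), hu 0 (by omega)]
      exact hz.default i (by omega)

/-- The position in the order of construction of the vertex `i` of a path. -/
def pos (h i : ℕ) : ℕ := if 2 * h + 1 < i then 0 else if h ≤ i then i - h else 2 * h + 1 - i

theorem exists_pos_eq {τ : ℕ} (hτ : τ ≤ 2 * h + 1) : ∃ i ≤ 2 * h + 1, pos h i = τ := by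
  rcases Nat.lt_or_ge (h + 1) τ with h1 | h1
  · exact ⟨2 * h + 1 - τ, by omega, by unfold pos; split_ifs <;> omega⟩
  · exact ⟨τ + h, by omega, by unfold pos; split_ifs <;> omega⟩

theorem Grow.good {S : V × V → Finset V} {z : ℕ → V} (hz : G.Grow S z (2 * h + 1)) :
    G.Good fun i => z (pos h i) := by
  have hle : ∀ i, pos h i ≤ 2 * h + 1 := fun i => by unfold pos; split_ifs <;> omega
  have hedge : ∀ i < 2 * h + 1, ∃ τ, 1 ≤ τ ∧ τ ≤ 2 * h + 1 ∧
      stepEdge (fun i => z (pos h i)) i = s(z (par h τ), z τ) ∧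
      (τ = if h ≤ i then i - h + 1 else 2 * h + 1 - i) := by
    intro i hi
    refine ⟨_, ?_, ?_, ?_, rfl⟩
    · split_ifs <;> omega
    · split_ifs <;> omega
    · simp only [stepEdge]
      split_ifs with h1
      · have e1 : pos h i = par h (i - h + 1) := by unfold pos par; split_ifs <;> omega
        have e2 : pos h (i + 1) = i - h + 1 := by unfold pos; split_ifs <;> omega
        rw [e1, e2]
      · have e1 : pos h (i + 1) = par h (2 * h + 1 - i) := by unfold pos par; split_ifs <;> omega
        have e2 : pos h i = 2 * h + 1 - i := by unfold pos; split_ifs <;> omega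
        rw [e1, e2, Sym2.eq_swap]
  have hmid : stepEdge (fun i => z (pos h i)) h = s(z 0, z 1) := by
    have e1 : pos h h = 0 := by unfold pos; split_ifs <;> omega
    have e2 : pos h (h + 1) = 1 := by unfold pos; split_ifs <;> omega
    simp only [stepEdge, e1, e2]
  refine ⟨⟨⟨fun i hi => ?_, fun i hi j hj he => ?_⟩, fun i j hij hj hb => ?_⟩, fun i hi => ?_,
    fun i j h1 h2 h3 e he => ?_, fun i j h1 h2 e he => ?_⟩
  · obtain ⟨τ, h1, h2, h3, -⟩ := hedge i hi
    have := hz.adj τ h1 h2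
    rw [← SimpleGraph.mem_edgeSet, ← h3] at this
    exact this
  · have := hz.inj _ (hle i) _ (hle j) he
    unfold pos at this
    split_ifs at this <;> omega
  · obtain ⟨σ, h1, h2, h3, h4⟩ := hedge i (by omega)
    obtain ⟨τ, h5, h6, h7, h8⟩ := hedge j hj
    rcases lt_trichotomy σ τ with hlt | heq | hlt
    · rw [h3, h7] at hb
      exact hz.free σ τ h1 hlt h6 _ hb (Sym2.mem_mk_right _ _)
    · split_ifs at h4 h8 <;> omega
    · have hb := G.bl_symm _ _ hb
      rw [h3, h7] at hb
      exact hz.free τ σ h5 hlt h2 _ hb (Sym2.mem_mk_right _ _)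
  · obtain ⟨τ, h1, h2, h3, -⟩ := hedge i hi
    rw [hmid, h3]
    exact hz.rank τ h1 h2
  · obtain ⟨σ, h4, h5, h6, h7⟩ := hedge i (by omega)
    rw [h6] at he
    have e1 : pos h j = j - h := by unfold pos; split_ifs <;> omega
    refine hz.free σ (pos h j) h4 ?_ (hle j) e he
    rw [if_pos h1] at h7
    omega
  · obtain ⟨σ, h4, h5, h6, h7⟩ := hedge i (by omega)
    rw [h6] at he
    have e1 : pos h j = 2 * h + 1 - j := by unfold pos; split_ifs <;> omega
    refine hz.free σ (pos h j) h4 ?_ (hle j) e he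
    split_ifs at h7 <;> omega

variable (G) in
/-- A graph with many edges contains many good paths. -/
theorem exists_goodPaths [Fintype V] {d : ℕ} (hd : 2 * h + 2 + 2 * f * (2 * h + 1) ≤ d)
    (hG : 5 * (Fintype.card V * d) ≤ ∑ u, (G.nbrs u).card) :
    ∃ P : Finset (ℕ → V), (∀ p ∈ P, G.Good p) ∧
      (∀ p ∈ P, ∀ q ∈ P, Set.EqOn p q (Set.Iic (2 * h + 1)) → p = q) ∧
      Fintype.card V * d ^ (2 * h + 1) ≤ P.card := by
  classical
  obtain ⟨C, hC, hCcard⟩ := G.exists_coreDarts (2 * d)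
  have hCcard' : Fintype.card V * d ≤ C.card := by
    have : 2 * (2 * d) * Fintype.card V = 4 * (Fintype.card V * d) := by ring
    omega
  choose hCa hCS using hC
  choose! S hS using hCS
  have hfam : ∀ m, m ≤ 2 * h → ∃ Z : Finset (ℕ → V), d ^ m * C.card ≤ Z.card ∧
      ∀ z ∈ Z, (z 0, z 1) ∈ C ∧ G.Grow S z (m + 1) := by
    intro m
    induction m with
    | zero =>
      intro _
      refine ⟨C.image fun x => Function.update (fun _ => x.1) 1 x.2, ?_, ?_⟩
      · rw [pow_zero, one_mul, Finset.card_image_of_injective]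
        intro x y he
        have h0 := congrFun he 0
        have h1 := congrFun he 1
        simp only [Function.update_self] at h1
        exact Prod.ext (by simpa using h0) h1
      · simp only [Finset.mem_image]
        rintro _ ⟨⟨u, v⟩, hx, rfl⟩
        have e0 : Function.update (fun _ => u) 1 v 0 = u := by simp
        have e1 : Function.update (fun _ => u) 1 v 1 = v := by simp
        have hc := hS _ hx
        have ha : G.graph.Adj u v := hCa _ hx
        have hp : par h 1 = 0 := by unfold par; split_ifs <;> omega
        refine ⟨by rw [e0, e1]; exact hx, fun i hi => ?_, fun i hi j hj he => ?_,
          fun τ h1 h2 => ?_, fun τ h1 h2 => ?_, fun σ τ h1 h2 h3 => by omega, fun i hi => ?_⟩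
        · rw [e0, e1]
          obtain rfl | rfl : i = 0 ∨ i = 1 := by omega
          · rw [e0]; exact hc.1
          · rw [e1]; exact hc.2.1
        · obtain rfl | rfl : i = 0 ∨ i = 1 := by omega
          · obtain rfl | rfl : j = 0 ∨ j = 1 := by omega
            · rfl
            · rw [e0, e1] at he; exact absurd he ha.ne
          · obtain rfl | rfl : j = 0 ∨ j = 1 := by omega
            · rw [e0, e1] at he; exact absurd he ha.ne'
            · rfl
        · obtain rfl : τ = 1 := by omega
          rw [hp, e0, e1]; exact ha
        · obtain rfl : τ = 1 := by omega
          rw [hp]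
        · rw [e0, Function.update_of_ne (by omega)]
    | succ m ih =>
      intro hm
      obtain ⟨Z, hZ, hZG⟩ := ih (by omega)
      obtain ⟨Z', hZ', hQ⟩ := exists_update_family Z (m := m + 1) (d := d)
        (fun z hz => (hZG z hz).2.default _ (by omega))
        (fun z => (z 0, z 1) ∈ C ∧ G.Grow S z (m + 2)) fun z hz => by
          obtain ⟨N, hN, hNG⟩ := (hZG z hz).2.exists_extend (by omega) (by omega)
            (hS _ (hZG z hz).1) hd
          refine ⟨N, hN, fun x hx => ⟨?_, hNG x hx⟩⟩
          rw [Function.update_of_ne (by omega), Function.update_of_ne (by omega)]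
          exact (hZG z hz).1
      refine ⟨Z', le_trans ?_ hZ', hQ⟩
      rw [pow_succ', mul_assoc]
      exact Nat.mul_le_mul_left _ hZ
  obtain ⟨Z, hZ, hZG⟩ := hfam (2 * h) le_rfl
  refine ⟨Z.image fun z i => z (pos h i), ?_, ?_, ?_⟩
  · simp only [Finset.mem_image]
    rintro _ ⟨z, hz, rfl⟩
    exact (hZG z hz).2.good
  · simp only [Finset.mem_image]
    rintro _ ⟨z, hz, rfl⟩ _ ⟨z', hz', rfl⟩ he
    funext i
    rcases Nat.lt_or_ge (2 * h + 1) i with hi | hi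
    · have e1 : pos h i = pos h h := by unfold pos; split_ifs <;> omega
      have := he (show h ∈ Set.Iic (2 * h + 1) from Set.mem_Iic.2 (by omega))
      simpa only [e1] using this
    · exact he hi
  · rw [Finset.card_image_of_injOn]
    · refine le_trans ?_ hZ
      rw [pow_succ, mul_left_comm]
      exact Nat.mul_le_mul_left _ hCcard'
    · intro z hz z' hz' he
      funext τ
      have key : ∀ τ ≤ 2 * h + 1, z τ = z' τ := fun τ hτ => by
        obtain ⟨i, -, rfl⟩ := exists_pos_eq hτ
        exact congrFun he i
      rcases Nat.lt_or_ge (2 * h + 1) τ with hτ | hτ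
      · rw [(hZG z hz).2.default τ hτ, (hZG z' hz').2.default τ hτ, key 0 (by omega)]
      · exact key τ hτ

variable (G) in
/-- The `(2h+1)`-st power of the average degree of a graph whose maximum degree is comparable to it
is at most linear in the number of vertices. -/
theorem pow_le_two_mul_card [Fintype V] [Nonempty V] {X d : ℕ} (hD : D = 40 * d)
    (hX : X * F ^ (h + 1) ≤ D)
    (hX1 : 4 * ((2 * h + 2) ^ 5 * (h + 1) ^ 4 * 40 ^ (2 * h + 1)) ≤ X)
    (hF : (2 * h + 1) * (2 * h + 1) * (2 * (f + 1)) ≤ F)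
    (hd : 2 * h + 2 + 2 * f * (2 * h + 1) ≤ d)
    (hG : 5 * (Fintype.card V * d) ≤ ∑ u, (G.nbrs u).card) :
    d ^ (2 * h + 1) ≤ 2 * Fintype.card V := by
  obtain ⟨P, hP, hinj, hcard⟩ := G.exists_goodPaths hd hG
  have hXpos : 1 ≤ X := le_trans (Nat.succ_le_of_lt (by positivity)) hX1
  have h1 := card_good_le P hP hinj hX hXpos hF
  have hn : 0 < Fintype.card V := Fintype.card_pos
  generalize Fintype.card V = n at *
  have h2 : 2 * ((2 * h + 2) ^ 5 * (2 * ((h + 1) ^ 4 * n * D ^ (2 * h + 1)))) ≤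
      X * (n * d ^ (2 * h + 1)) := by
    calc _ = 4 * ((2 * h + 2) ^ 5 * (h + 1) ^ 4 * 40 ^ (2 * h + 1)) * (n * d ^ (2 * h + 1)) := by
          rw [hD, mul_pow]; ring
      _ ≤ _ := Nat.mul_le_mul_right _ hX1
  have h3 := Nat.mul_le_mul_left X hcard
  have h4 : X * (n * d ^ (2 * h + 1)) ≤ X * (n * (2 * n)) := by
    have : X * (n * (2 * n)) = 2 * (X * (n * n)) := by ring
    omega
  exact Nat.le_of_mul_le_mul_left (Nat.le_of_mul_le_mul_left h4 hXpos) hn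

end BlockedGraph

section Distances

variable {V : Type} {G H H' : SimpleGraph V} {w : Sym2 V → ℝ≥0∞} {δ : V → V → ℝ≥0∞}

theorem wdist_self (u : V) : wdist G w u u = 0 :=
  le_antisymm (iInf_le_of_le Walk.nil (by simp)) bot_le

theorem wdist_comm (u v : V) : wdist G w u v = wdist G w v u := by
  suffices h : ∀ u v, wdist G w u v ≤ wdist G w v u from le_antisymm (h u v) (h v u)
  refine fun u v => le_iInf fun p => iInf_le_of_le p.reverse (le_of_eq ?_)
  rw [Walk.edges_reverse, List.map_reverse, List.sum_reverse]

theorem wdist_triangle (u v x : V) : wdist G w u x ≤ wdist G w u v + wdist G w v x := by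
  refine ENNReal.le_iInf_add_iInf fun p q => iInf_le_of_le (p.append q) (le_of_eq ?_)
  rw [Walk.edges_append, List.map_append, List.sum_append]

theorem wdist_le_of_adj {u v : V} (h : G.Adj u v) : wdist G w u v ≤ w s(u, v) :=
  iInf_le_of_le h.toWalk (by simp)

theorem emulDist_self (u : V) : emulDist H δ u u = 0 :=
  le_antisymm (iInf_le_of_le Walk.nil (by simp)) bot_le

theorem emulDist_comm (hδ : ∀ u v, δ u v = δ v u) (u v : V) :
    emulDist H δ u v = emulDist H δ v u := by
  suffices h : ∀ u v, emulDist H δ u v ≤ emulDist H δ v u from le_antisymm (h u v) (h v u)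
  refine fun u v => le_iInf fun p => iInf_le_of_le p.reverse (le_of_eq ?_)
  rw [Walk.darts_reverse, List.map_reverse, List.sum_reverse, List.map_map]
  exact congrArg List.sum (List.map_congr_left fun d _ => hδ _ _)

theorem emulDist_triangle (u v x : V) :
    emulDist H δ u x ≤ emulDist H δ u v + emulDist H δ v x := by
  refine ENNReal.le_iInf_add_iInf fun p q => iInf_le_of_le (p.append q) (le_of_eq ?_)
  rw [Walk.darts_append, List.map_append, List.sum_append]

theorem emulDist_le_of_adj {u v : V} (h : H.Adj u v) : emulDist H δ u v ≤ δ u v :=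
  iInf_le_of_le h.toWalk (by simp)

theorem emulDist_mono (h : H ≤ H') (u v : V) : emulDist H' δ u v ≤ emulDist H δ u v := by
  refine le_iInf fun p => ?_
  induction p with
  | nil => rw [emulDist_self]; exact bot_le
  | @cons a b c hab p ih =>
    refine (emulDist_triangle a b c).trans ?_
    rw [Walk.darts_cons, List.map_cons, List.sum_cons]
    exact add_le_add (emulDist_le_of_adj (h hab)) ih

theorem le_emulDist (h0 : ∀ u, δ u u = 0) (ht : ∀ u v x, δ u x ≤ δ u v + δ v x) (u v : V) :
    δ u v ≤ emulDist H δ u v := by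
  refine le_iInf fun p => ?_
  induction p with
  | nil => rw [h0]; exact bot_le
  | @cons a b c hab p ih =>
    refine (ht a b c).trans ?_
    rw [Walk.darts_cons, List.map_cons, List.sum_cons]
    exact add_le_add le_rfl ih

theorem emulDist_le_mul_wdist {t : ℝ≥0∞} (ht0 : t ≠ 0) (ht : t ≠ ⊤)
    (h : ∀ u v, G.Adj u v → emulDist H δ u v ≤ t * w s(u, v)) (u v : V) :
    emulDist H δ u v ≤ t * wdist G w u v := by
  rw [wdist, ENNReal.mul_iInf_of_ne ht0 ht]
  refine le_iInf fun p => ?_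
  induction p with
  | nil => rw [emulDist_self]; exact bot_le
  | @cons a b c hab p ih =>
    refine (emulDist_triangle a b c).trans ?_
    rw [Walk.edges_cons, List.map_cons, List.sum_cons, mul_add]
    exact add_le_add (h _ _ hab) ih

/-- In a closed sequence the distance of two consecutive points is at most the sum of all other
such distances. -/
theorem dist_le_sum_erase (h0 : ∀ u, δ u u = 0) (hs : ∀ u v, δ u v = δ v u)
    (ht : ∀ u v x, δ u x ≤ δ u v + δ v x) {ω : ℕ → V} {L a : ℕ} (hω : ω L = ω 0) (ha : a < L) :
    δ (ω a) (ω (a + 1)) ≤ ∑ b ∈ (Finset.range L).erase a, δ (ω b) (ω (b + 1)) := by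
  have key : ∀ i n, δ (ω i) (ω (i + n)) ≤
      ∑ b ∈ Finset.Ico i (i + n), δ (ω b) (ω (b + 1)) := by
    intro i n
    induction n with
    | zero => simp [h0]
    | succ n ih =>
      rw [← add_assoc, Finset.sum_Ico_succ_top (by omega)]
      exact (ht _ (ω (i + n)) _).trans (add_le_add ih le_rfl)
  have hsplit : (Finset.range L).erase a = Finset.Ico 0 a ∪ Finset.Ico (a + 1) L := by
    ext b; simp only [Finset.mem_erase, Finset.mem_range, Finset.mem_union, Finset.mem_Ico]; omega
  rw [hsplit, Finset.sum_union (Finset.disjoint_left.2 fun b h1 h2 => by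
    rw [Finset.mem_Ico] at h1 h2; omega)]
  have h1 := key 0 a
  have h2 := key (a + 1) (L - (a + 1))
  rw [Nat.add_sub_cancel' ha] at h2
  rw [zero_add] at h1
  calc δ (ω a) (ω (a + 1)) ≤ δ (ω a) (ω 0) + δ (ω L) (ω (a + 1)) := by
        rw [hω]; exact ht _ _ _
    _ = δ (ω 0) (ω a) + δ (ω (a + 1)) (ω L) := by rw [hs (ω a), hs (ω L)]
    _ ≤ _ := add_le_add h1 h2

end Distances

/-- A set in which membership of each element is decided by the members of smaller rank. -/
theorem exists_greedy_set {α : Type} (π : α → ℕ) (Q : α → Set α → Prop) :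
    ∃ E : Set α, ∀ e, e ∈ E ↔ Q e {e' | e' ∈ E ∧ π e' < π e} := by
  let E : α → Prop := (measure π).wf.fix fun e ih => Q e {e' | ∃ h : π e' < π e, ih e' h}
  refine ⟨{e | E e}, fun e => ?_⟩
  have hE : E e = Q e {e' | ∃ _ : π e' < π e, E e'} := WellFounded.fix_eq _ _ e
  rw [Set.mem_ofPred_eq, hE]
  refine iff_of_eq (congrArg (Q e) (Set.ext fun e' => ?_))
  simp only [Set.mem_ofPred_eq, exists_prop, and_comm]

theorem exists_monotone_ranking {α β : Type} [Finite α] [LinearOrder β] (w : α → β) :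
    ∃ π : α → ℕ, Function.Injective π ∧ ∀ e e', π e ≤ π e' → w e ≤ w e' := by
  classical
  have := Fintype.ofFinite α
  let key : α → β ×ₗ Fin (Fintype.card α) := fun e => toLex (w e, Fintype.equivFin α e)
  have hkey : ∀ e e', key e < key e' →
      (Finset.univ.filter fun x => key x < key e).card <
        (Finset.univ.filter fun x => key x < key e').card := fun e e' h =>
    Finset.card_lt_card <| Finset.ssubset_iff_of_subset
      (fun x hx => by simp only [Finset.mem_filter_univ] at hx ⊢; exact hx.trans h) |>.2
      ⟨e, by simpa using h, by simp⟩
  refine ⟨fun e => (Finset.univ.filter fun x => key x < key e).card, fun e e' he => ?_,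
    fun e e' he => ?_⟩
  · rcases lt_trichotomy (key e) (key e') with h | h | h
    · exact absurd he (hkey _ _ h).ne
    · have : (w e, Fintype.equivFin α e) = (w e', Fintype.equivFin α e') := h
      exact (Fintype.equivFin α).injective (Prod.mk.inj this).2
    · exact absurd he (hkey _ _ h).ne'
  · by_contra! hlt
    exact absurd he (not_le.2 (hkey _ _ (Prod.Lex.toLex_lt_toLex.2 (Or.inl hlt))))

/-- The greedy emulator, together with the fault sets that forced its edges into it: in a short
closed walk the last edge was forced by faults on the other edges of the walk. -/
theorem exists_greedy_emulator {V : Type} [Fintype V] (G : SimpleGraph V) (w : Sym2 V → ℝ≥0∞)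
    (f : ℕ) {k : ℕ} (hk : 1 ≤ k) :
    ∃ (H : SimpleGraph V) (π : Sym2 V → ℕ) (B : Sym2 V → Finset (Sym2 V)),
      IsEFTEmulator G w H f ((2 * k - 1 : ℕ) : ℝ≥0∞) ∧ (∀ e, (B e).card ≤ f) ∧
      ∀ (ω : ℕ → V) (L : ℕ), L ≤ 2 * k → ω L = ω 0 → (∀ i < L, H.Adj (ω i) (ω (i + 1))) →
        (∀ i < L, ∀ j < L, stepEdge ω i = stepEdge ω j → i = j) →
        ∀ a < L, (∀ i < L, π (stepEdge ω i) ≤ π (stepEdge ω a)) →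
        ∃ b < L, b ≠ a ∧ stepEdge ω b ∈ B (stepEdge ω a) ∧
          (L ≤ k + 1 → ∃ b' < L, b' ≠ a ∧ b' ≠ b ∧ stepEdge ω b' ∈ B (stepEdge ω a)) := by
  classical
  obtain ⟨π, hπ, hπw⟩ := exists_monotone_ranking w
  set t : ℝ≥0∞ := ((2 * k - 1 : ℕ) : ℝ≥0∞) with ht
  obtain ⟨E, hE⟩ := exists_greedy_set π fun e A => e ∈ G.edgeSet ∧
    ∃ F : Finset (Sym2 V), ↑F ⊆ G.edgeSet ∧ F.card ≤ f ∧ e ∉ F ∧ ∃ x y, e = s(x, y) ∧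
      t * w e < emulDist (fromEdgeSet A) (wdist (G.deleteEdges ↑F) w) x y
  have hEG : E ⊆ G.edgeSet := fun e he => ((hE e).1 he).1
  have hB : ∀ e, ∃ F : Finset (Sym2 V), F.card ≤ f ∧ (e ∈ E → e ∉ F ∧ ∃ x y, e = s(x, y) ∧
      t * w e < emulDist (fromEdgeSet {e' | e' ∈ E ∧ π e' < π e})
        (wdist (G.deleteEdges ↑F) w) x y) := fun e => by
    by_cases he : e ∈ E
    · obtain ⟨-, F, -, h2, h3⟩ := (hE e).1 he
      exact ⟨F, h2, fun _ => h3⟩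
    · exact ⟨∅, by simp, fun h => absurd h he⟩
  choose B hBf hB using hB
  have hHE : ∀ u v, (fromEdgeSet E).Adj u v → s(u, v) ∈ E := fun u v h => by
    rw [fromEdgeSet_adj] at h; exact h.1
  refine ⟨fromEdgeSet E, π, B, fun F hF hFf u v => ⟨le_emulDist wdist_self wdist_triangle u v,
    emulDist_le_mul_wdist (by rw [ht]; exact_mod_cast (by omega : 2 * k - 1 ≠ 0))
      (by rw [ht]; exact ENNReal.natCast_ne_top _) (fun x y hxy => ?_) u v⟩, hBf,
    fun ω L hL hω hadj hinj a ha hmax => ?_⟩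
  · have hxyG := (deleteEdges_adj.1 hxy)
    by_cases he : s(x, y) ∈ E
    · have h1 : (1 : ℝ≥0∞) ≤ t := by
        rw [ht]; exact_mod_cast (by omega : 1 ≤ 2 * k - 1)
      calc _ ≤ wdist (G.deleteEdges ↑F) w x y :=
            emulDist_le_of_adj ((fromEdgeSet_adj _).2 ⟨he, hxy.ne⟩)
        _ ≤ w s(x, y) := wdist_le_of_adj hxy
        _ ≤ t * w s(x, y) := le_mul_of_one_le_left bot_le h1
    · rw [hE] at he
      refine (emulDist_mono (fromEdgeSet_mono
        (Set.sep_subset E fun e' => π e' < π s(x, y))) x y).trans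
        (not_lt.1 fun hlt => ?_)
      exact he ⟨hxyG.1, F, hF, hFf, hxyG.2, x, y, rfl, hlt⟩
  · have hmem : ∀ i < L, stepEdge ω i ∈ E := fun i hi => hHE _ _ (hadj i hi)
    obtain ⟨haF, x, y, hxy, hlt⟩ := hB _ (hmem a ha)
    set F := B (stepEdge ω a)
    set δ := wdist (G.deleteEdges (↑F : Set (Sym2 V))) w with hδ
    set A := fromEdgeSet {e' | e' ∈ E ∧ π e' < π (stepEdge ω a)}
    have hw : ∀ i < L, stepEdge ω i ∉ F → δ (ω i) (ω (i + 1)) ≤ w (stepEdge ω a) := by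
      intro i hi hiF
      exact (wdist_le_of_adj (deleteEdges_adj.2 ⟨hEG (hmem i hi), hiF⟩)).trans
        (hπw _ _ (hmax i hi))
    have hlt' : t * w (stepEdge ω a) < ∑ b ∈ (Finset.range L).erase a, δ (ω b) (ω (b + 1)) := by
      have h1 : emulDist A δ x y = emulDist A δ (ω a) (ω (a + 1)) := by
        rcases Sym2.eq_iff.1 hxy with ⟨rfl, rfl⟩ | ⟨rfl, rfl⟩
        · rfl
        · exact emulDist_comm wdist_comm _ _
      rw [h1] at hlt
      refine hlt.trans_le ((dist_le_sum_erase emulDist_self (emulDist_comm wdist_comm)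
        emulDist_triangle hω ha).trans (Finset.sum_le_sum fun b hb => emulDist_le_of_adj ?_))
      rw [Finset.mem_erase, Finset.mem_range] at hb
      refine (fromEdgeSet_adj _).2 ⟨⟨hmem b hb.2, lt_of_le_of_ne (hmax b hb.2) fun he => ?_⟩,
        (hadj b hb.2).ne⟩
      exact hb.1 (hinj _ hb.2 _ ha (hπ he))
    have hsum : ∀ S : Finset ℕ, (∀ i ∈ S, i < L ∧ stepEdge ω i ∉ F) →
        ∑ b ∈ S, δ (ω b) (ω (b + 1)) ≤ S.card * w (stepEdge ω a) := fun S hS => by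
      rw [← nsmul_eq_mul]
      exact Finset.sum_le_card_nsmul _ _ _ fun i hi => hw i (hS i hi).1 (hS i hi).2
    have hcard : ((Finset.range L).erase a).card = L - 1 := by
      rw [Finset.card_erase_of_mem (Finset.mem_range.2 ha), Finset.card_range]
    have hex : ∃ b < L, b ≠ a ∧ stepEdge ω b ∈ F := by
      by_contra! hno
      refine absurd (hlt'.trans_le (hsum _ fun i hi => ?_)) (not_lt.2 ?_)
      · rw [Finset.mem_erase, Finset.mem_range] at hi
        exact ⟨hi.2, hno i hi.2 hi.1⟩
      · rw [hcard, ht]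
        gcongr
    obtain ⟨b, hb, hba, hbF⟩ := hex
    refine ⟨b, hb, hba, hbF, fun hLk => ?_⟩
    by_contra! hno
    have hnoF : ∀ i < L, i ≠ b → stepEdge ω i ∉ F := fun i hi hib => by
      by_cases hia : i = a
      · rw [hia]; exact haF
      · exact hno i hi hia hib
    have hb' : b ∈ (Finset.range L).erase a := by
      rw [Finset.mem_erase, Finset.mem_range]; exact ⟨hba, hb⟩
    have h1 := hsum ((Finset.range L).erase b) fun i hi => by
      rw [Finset.mem_erase, Finset.mem_range] at hi
      exact ⟨hi.2, hnoF i hi.2 hi.1⟩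
    have h2 := hsum (((Finset.range L).erase a).erase b) fun i hi => by
      rw [Finset.mem_erase, Finset.mem_erase, Finset.mem_range] at hi
      exact ⟨hi.2.2, hnoF i hi.2.2 hi.1⟩
    rw [Finset.card_erase_of_mem (Finset.mem_range.2 hb), Finset.card_range] at h1
    rw [Finset.card_erase_of_mem hb', hcard] at h2
    rw [← Finset.add_sum_erase _ _ hb'] at hlt'
    refine absurd (hlt'.trans_le (add_le_add ((dist_le_sum_erase wdist_self wdist_comm
      wdist_triangle hω hb).trans h1) h2)) (not_lt.2 ?_)
    rw [← add_mul, ← Nat.cast_add, ht]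
    gcongr
    omega

/-- Discarding the elements contained in more than `2f` of the sets `B e`, at least half of the
elements remain, and the relation given by `B` becomes part of a symmetric one in which every
element is related to at most `3f` others. -/
theorem exists_symm_relation {α : Type} [DecidableEq α] (E : Finset α) (B : α → Finset α) {f : ℕ}
    (hf : 0 < f) (hB : ∀ e, (B e).card ≤ f) :
    ∃ E' ⊆ E, E.card ≤ 2 * E'.card ∧ ∃ bl : α → Finset α, (∀ e e', e' ∈ bl e → e ∈ bl e') ∧
      (∀ e, (bl e).card ≤ 3 * f) ∧ ∀ e ∈ E', ∀ e' ∈ E', e' ∈ B e → e' ∈ bl e := by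
  let c : α → ℕ := fun e => (E.filter fun e' => e ∈ B e').card
  refine ⟨E.filter fun e => c e ≤ 2 * f, Finset.filter_subset _ _, ?_, fun e =>
    (E.filter fun e' => c e' ≤ 2 * f).filter fun e' => (e ∈ E ∧ c e ≤ 2 * f) ∧
      (e' ∈ B e ∨ e ∈ B e'), ?_, fun e => ?_, ?_⟩
  · have h1 : (E.filter fun e => ¬ c e ≤ 2 * f).card * (2 * f) ≤ E.card * f := by
      calc _ ≤ ∑ e ∈ E.filter fun e => ¬ c e ≤ 2 * f, c e := by
            rw [← smul_eq_mul]
            exact Finset.card_nsmul_le_sum _ _ _ fun e he =>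
              (not_le.1 (Finset.mem_filter.1 he).2).le
        _ ≤ ∑ e ∈ E, c e := Finset.sum_le_sum_of_subset (Finset.filter_subset _ _)
        _ = ∑ e' ∈ E, (E.filter fun e => e ∈ B e').card :=
            Finset.sum_card_bipartiteAbove_eq_sum_card_bipartiteBelow _
        _ ≤ E.card * f := by
            rw [← smul_eq_mul]
            exact Finset.sum_le_card_nsmul _ _ _ fun e' _ => (Finset.card_le_card fun e he =>
              (Finset.mem_filter.1 he).2).trans (hB e')
    have h2 : 2 * (E.filter fun e => ¬ c e ≤ 2 * f).card ≤ E.card := by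
      refine Nat.le_of_mul_le_mul_right ?_ hf
      calc _ = (E.filter fun e => ¬ c e ≤ 2 * f).card * (2 * f) := by ring
        _ ≤ _ := h1
    have h3 := Finset.card_filter_add_card_filter_not (s := E) (fun e => c e ≤ 2 * f)
    omega
  · intro e e' he
    simp only [Finset.mem_filter] at he ⊢
    exact ⟨he.2.1, he.1, he.2.2.symm⟩
  · by_cases he : c e ≤ 2 * f
    · refine (Finset.card_le_card (t := B e ∪ E.filter fun e' => e ∈ B e') fun e' h => ?_).trans
        ((Finset.card_union_le _ _).trans ?_)
      · simp only [Finset.mem_filter, Finset.mem_union] at h ⊢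
        exact h.2.2.imp id fun h' => ⟨h.1.1, h'⟩
      · have := hB e
        have : (E.filter fun e' => e ∈ B e').card ≤ 2 * f := he
        omega
    · exact (Finset.card_eq_zero.2 (Finset.filter_eq_empty_iff.2 fun e' _ h' => he h'.1.2)).trans_le
        (Nat.zero_le _)
  · intro e he e' he' hb
    rw [Finset.mem_filter] at he
    exact Finset.mem_filter.2 ⟨he', he, Or.inl hb⟩

/-- There is an emulator with few more edges than a graph with suitably blocked edges. -/
theorem exists_emulator_blockedGraph {V : Type} [Fintype V] (G : SimpleGraph V)
    (w : Sym2 V → ℝ≥0∞) {f : ℕ} (hf : 0 < f) (h : ℕ) :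
    ∃ H : SimpleGraph V, IsEFTEmulator G w H f ((2 * (2 * h + 1) - 1 : ℕ) : ℝ≥0∞) ∧
      ∃ K : BlockedGraph V h (3 * f) (Fintype.card V),
        H.edgeSet.ncard ≤ ∑ u, (K.nbrs u).card := by
  classical
  obtain ⟨H, π, B, hH, hB, hclosed⟩ := exists_greedy_emulator G w f (k := 2 * h + 1) (by omega)
  obtain ⟨E, hEH, hcard, bl, hsymm, hbl, hBE⟩ := exists_symm_relation H.edgeFinset B hf hB
  obtain ⟨K, hK⟩ : ∃ K : SimpleGraph V, K.edgeSet = E := by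
    refine ⟨fromEdgeSet E, ?_⟩
    rw [edgeSet_fromEdgeSet]
    exact sdiff_eq_left.2 (Set.disjoint_left.2 fun e he hd =>
      H.not_isDiag_of_mem_edgeSet (mem_edgeFinset.1 (hEH he)) hd)
  have hadj : ∀ u v, K.Adj u v → s(u, v) ∈ E ∧ H.Adj u v := by
    intro u v huv
    have : s(u, v) ∈ (E : Set (Sym2 V)) := hK ▸ huv
    exact ⟨this, by simpa using hEH this⟩
  refine ⟨H, hH, ⟨K, fun u => K.neighborFinset u, fun u v => mem_neighborFinset ..,
    fun u => Finset.card_le_univ _, π, bl, hsymm, hbl, ?_⟩, ?_⟩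
  · intro ω L hL hω ha hinj a haL hmax
    have hE : ∀ i < L, stepEdge ω i ∈ E := fun i hi => (hadj _ _ (ha i hi)).1
    obtain ⟨b, hb, hba, hbB, hb'⟩ := hclosed ω L hL hω (fun i hi => (hadj _ _ (ha i hi)).2) hinj a
      haL hmax
    refine ⟨b, hb, hba, hBE _ (hE a haL) _ (hE b hb) hbB, fun hL' => ?_⟩
    obtain ⟨b', h1, h2, h3, h4⟩ := hb' hL'
    exact ⟨b', h1, h2, h3, hBE _ (hE a haL) _ (hE b' h1) h4⟩
  · have hKE : K.edgeFinset = E := by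
      ext e
      rw [mem_edgeFinset, hK, Finset.mem_coe]
    have hsum := sum_degrees_eq_twice_card_edges K
    rw [hKE] at hsum
    rw [Set.ncard_eq_toFinset_card']
    exact hcard.trans hsum.ge

namespace BlockedGraph

variable {V : Type} {h f D Δ : ℕ} (G : BlockedGraph V h f Δ)

theorem exists_index : ∃ idx : V → V → ℕ,
    (∀ u, ∀ v ∈ G.nbrs u, ∀ v' ∈ G.nbrs u, idx u v = idx u v' → v = v') ∧
    ∀ u, ∀ v ∈ G.nbrs u, idx u v < (G.nbrs u).card := by
  classical
  refine ⟨fun u v => if hv : v ∈ G.nbrs u then ((G.nbrs u).equivFin ⟨v, hv⟩ : ℕ) else 0,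
    fun u v hv v' hv' he => ?_, fun u v hv => ?_⟩
  · simp only [dif_pos hv, dif_pos hv'] at he
    exact congrArg Subtype.val ((G.nbrs u).equivFin.injective (Fin.ext he))
  · simp only [dif_pos hv]
    exact Fin.is_lt _

/-- Splitting vertices reduces the maximum degree to `D` without changing the number of edges. -/
theorem exists_split [Fintype V] [Nonempty V] (hD : 0 < D) :
    ∃ (V' : Type) (_ : Fintype V') (_ : Nonempty V') (G' : BlockedGraph V' h f D),
      D * Fintype.card V' ≤ D * Fintype.card V + ∑ u, (G.nbrs u).card ∧
      ∑ u, (G.nbrs u).card ≤ ∑ u, (G'.nbrs u).card := by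
  classical
  obtain ⟨idx, hinj, hlt⟩ := G.exists_index
  let W : Type := Σ v : V, Fin ((G.nbrs v).card / D + 1)
  have hext : ∀ x y : W, x.1 = y.1 → (x.2 : ℕ) = y.2 → x = y := by
    rintro ⟨v, c⟩ ⟨v', c'⟩ h1 h2
    obtain rfl : v = v' := h1
    exact congrArg (Sigma.mk v) (Fin.ext h2)
  let A : SimpleGraph W :=
    { Adj := fun x y => G.graph.Adj x.1 y.1 ∧ (x.2 : ℕ) = idx x.1 y.1 / D ∧
        (y.2 : ℕ) = idx y.1 x.1 / D
      symm := ⟨fun x y hxy => ⟨hxy.1.symm, hxy.2.2, hxy.2.1⟩⟩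
      loopless := ⟨fun x hx => hx.1.ne rfl⟩ }
  have hA : ∀ x y, A.Adj x y → G.graph.Adj x.1 y.1 ∧ (x.2 : ℕ) = idx x.1 y.1 / D ∧
      (y.2 : ℕ) = idx y.1 x.1 / D := fun _ _ => id
  let π : Sym2 W → Sym2 V := Sym2.map Sigma.fst
  have hπ : ∀ e ∈ A.edgeSet, ∀ e' ∈ A.edgeSet, π e = π e' → e = e' := by
    refine Sym2.ind fun x y hxy => Sym2.ind fun x' y' hxy' he => ?_
    have h1 := hA _ _ hxy
    have h2 := hA _ _ hxy'
    simp only [π, Sym2.map_mk, Sym2.eq_iff] at he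
    rcases he with ⟨e1, e2⟩ | ⟨e1, e2⟩
    · rw [hext x x' e1 (by rw [h1.2.1, h2.2.1, e1, e2]),
        hext y y' e2 (by rw [h1.2.2, h2.2.2, e1, e2])]
    · rw [hext x y' e1 (by rw [h1.2.1, h2.2.2, e1, e2]),
        hext y x' e2 (by rw [h1.2.2, h2.2.1, e1, e2]), Sym2.eq_swap]
  refine ⟨W, inferInstance, ⟨⟨Classical.arbitrary V, 0⟩⟩, ⟨A, fun x => A.neighborFinset x,
    fun x y => mem_neighborFinset .., fun x => ?_, fun e => G.rank (π e),
    fun e => A.edgeFinset.filter fun e' => e ∈ A.edgeSet ∧ π e' ∈ G.bl (π e), ?_, fun e => ?_,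
    ?_⟩, ?_, ?_⟩
  · have hcard : (Finset.Ico ((x.2 : ℕ) * D) (x.2 * D + D)).card = D := by simp
    have hx : ∀ y ∈ A.neighborFinset x, y.1 ∈ G.nbrs x.1 := fun y hy =>
      (G.mem_nbrs _ _).2 (hA _ _ ((mem_neighborFinset ..).1 hy)).1
    refine (Finset.card_le_card_of_injOn (fun y => idx x.1 y.1) (fun y hy => ?_)
      fun y hy y' hy' he => ?_).trans hcard.le
    · have h1 := (hA _ _ ((mem_neighborFinset ..).1 hy)).2.1
      simp only [Finset.coe_Ico, Set.mem_Ico]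
      rw [h1]
      have h2 := Nat.div_add_mod (idx x.1 y.1) D
      have h3 := Nat.mod_lt (idx x.1 y.1) hD
      rw [mul_comm] at h2
      omega
    · have h1 := hinj _ _ (hx y hy) _ (hx y' hy') he
      refine hext y y' h1 ?_
      rw [(hA _ _ ((mem_neighborFinset ..).1 hy)).2.2, (hA _ _ ((mem_neighborFinset ..).1 hy')).2.2,
        h1]
  · intro e e' he
    simp only [Finset.mem_filter, mem_edgeFinset] at he ⊢
    exact ⟨he.2.1, he.1, G.bl_symm _ _ he.2.2⟩
  · refine le_trans (Finset.card_le_card_of_injOn π (fun e' he' => ?_) fun e₁ h₁ e₂ h₂ => ?_)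
      (G.card_bl (π e))
    · exact (Finset.mem_filter.1 he').2.2
    · exact hπ _ (mem_edgeFinset.1 (Finset.mem_filter.1 h₁).1) _
        (mem_edgeFinset.1 (Finset.mem_filter.1 h₂).1)
  · intro ω L hL hω ha hi a haL hmax
    have hmem : ∀ i < L, stepEdge ω i ∈ A.edgeSet := fun i hi => ha i hi
    obtain ⟨b, hb, hba, hbl, hb'⟩ := G.closed (fun i => (ω i).1) L hL (by rw [hω])
      (fun i hi => (hA _ _ (ha i hi)).1)
      (fun i hi' j hj he => hi i hi' j hj (hπ _ (hmem i hi') _ (hmem j hj) he)) a haL hmax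
    have hin : ∀ i < L, stepEdge (fun i => (ω i).1) i ∈ G.bl (stepEdge (fun i => (ω i).1) a) →
        stepEdge ω i ∈ A.edgeFinset.filter
          fun e' => stepEdge ω a ∈ A.edgeSet ∧ π e' ∈ G.bl (π (stepEdge ω a)) := fun i hi he =>
      Finset.mem_filter.2 ⟨mem_edgeFinset.2 (hmem i hi), hmem a haL, he⟩
    refine ⟨b, hb, hba, hin b hb hbl, fun hL' => ?_⟩
    obtain ⟨b', h1, h2, h3, h4⟩ := hb' hL'
    exact ⟨b', h1, h2, h3, hin b' h1 h4⟩
  · rw [Fintype.card_sigma]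
    simp only [Fintype.card_fin]
    rw [Finset.sum_add_distrib, mul_add, Finset.mul_sum, add_comm]
    refine add_le_add (by simp) (Finset.sum_le_sum fun u _ => Nat.mul_div_le _ _)
  · have hc : ∀ u, ∀ v ∈ G.nbrs u, idx u v / D < (G.nbrs u).card / D + 1 := fun u v hv =>
      Nat.lt_succ_of_le (Nat.div_le_div_right (hlt u v hv).le)
    let g : V → V → W := fun u v => if hv : v ∈ G.nbrs u then ⟨u, ⟨idx u v / D, hc u v hv⟩⟩
      else ⟨u, 0⟩
    have hg : ∀ u v, (g u v).1 = u := fun u v => by simp only [g]; split_ifs <;> rfl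
    have hg2 : ∀ u, ∀ v ∈ G.nbrs u, ((g u v).2 : ℕ) = idx u v / D := fun u v hv => by
      have : g u v = ⟨u, ⟨idx u v / D, hc u v hv⟩⟩ := dif_pos hv
      rw [this]
    rw [← Finset.card_sigma, ← Finset.card_sigma]
    refine Finset.card_le_card_of_injOn (fun x => ⟨g x.1 x.2, g x.2 x.1⟩) ?_ ?_
    · rintro ⟨u, v⟩ huv
      have hv : v ∈ G.nbrs u := by simpa using huv
      have hadj := (G.mem_nbrs u v).1 hv
      have hu : u ∈ G.nbrs v := (G.mem_nbrs v u).2 hadj.symm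
      simp only [Finset.coe_sigma, Set.mem_sigma_iff, Finset.coe_univ, Set.mem_univ, true_and,
        Finset.mem_coe, mem_neighborFinset]
      exact ⟨by rwa [hg, hg], by rw [hg2 u v hv, hg, hg], by rw [hg2 v u hu, hg, hg]⟩
    · rintro ⟨u, v⟩ - ⟨u', v'⟩ - he
      simp only [Sigma.mk.injEq, heq_eq_eq] at he
      have h1 := congrArg Sigma.fst he.1
      have h2 := congrArg Sigma.fst he.2
      rw [hg, hg] at h1 h2
      rw [h1, h2]

end BlockedGraph

/-- The number of edges of a graph with suitably blocked edges, in terms of a bound `d` on its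
average degree. -/
theorem BlockedGraph.exists_degree_bound {V : Type} [Fintype V] [Nonempty V] {h f Δ : ℕ}
    (G : BlockedGraph V h f Δ) :
    ∃ d : ℕ, ∑ u, (G.nbrs u).card ≤ 20 * (Fintype.card V * d) ∧
      (d ^ (2 * h + 1) ≤ 4 * Fintype.card V ∨
        d ≤ 4 * ((2 * h + 2) ^ 5 * (h + 1) ^ 4 * 40 ^ (2 * h + 1)) *
          ((2 * h + 1) * (2 * h + 1) * (2 * (f + 1))) ^ (h + 1)) := by
  set M := ∑ u, (G.nbrs u).card with hM
  have hn : 0 < Fintype.card V := Fintype.card_pos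
  set n := Fintype.card V with hn'
  set X := 4 * ((2 * h + 2) ^ 5 * (h + 1) ^ 4 * 40 ^ (2 * h + 1)) with hX
  set F := (2 * h + 1) * (2 * h + 1) * (2 * (f + 1)) with hF
  have hdiv := Nat.div_add_mod M (10 * n)
  have hmod := Nat.mod_lt M (show 0 < 10 * n by omega)
  set d := M / (10 * n)
  rw [mul_assoc] at hdiv
  rcases Nat.eq_zero_or_pos d with hd | hd
  · exact ⟨1, by rw [hd] at hdiv; omega, Or.inl (by rw [one_pow]; omega)⟩
  have hnd : n ≤ n * d := Nat.le_mul_of_pos_right _ hd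
  refine ⟨d, by omega, ?_⟩
  by_cases hXd : X * F ^ (h + 1) ≤ 40 * d
  · left
    obtain ⟨V', _, _, G', h1, h2⟩ := G.exists_split (D := 40 * d) (by omega)
    rw [← hM, ← hn'] at h1
    rw [← hM] at h2
    have e1 : 40 * d * Fintype.card V' = 40 * (Fintype.card V' * d) := by ring
    have e2 : 40 * d * n = 40 * (n * d) := by ring
    rw [e1, e2] at h1
    have h3 : Fintype.card V' ≤ 2 * n := by
      refine Nat.le_of_mul_le_mul_right ?_ hd
      rw [mul_assoc]
      omega
    have h4 : 2 * h + 2 + 2 * f * (2 * h + 1) ≤ d := by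
      refine Nat.le_of_mul_le_mul_left (le_trans ?_ hXd) (show 0 < 40 by norm_num)
      refine Nat.mul_le_mul ?_ ?_
      · calc 40 = 4 * (1 * 1 * 10) := by norm_num
          _ ≤ X := by
            rw [hX]
            gcongr
            · exact Nat.one_le_pow _ _ (by omega)
            · exact Nat.one_le_pow _ _ (by omega)
            · exact (show 10 ≤ 40 ^ 1 by norm_num).trans (Nat.pow_le_pow_right (by norm_num)
                (by omega))
      · calc 2 * h + 2 + 2 * f * (2 * h + 1) ≤ 1 * (2 * h + 1) * (2 * (f + 1)) := by
              nlinarith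
          _ ≤ F := by
              rw [hF]
              gcongr
              omega
          _ ≤ F ^ (h + 1) := Nat.le_self_pow (by omega) _
    have := G'.pow_le_two_mul_card rfl hXd le_rfl le_rfl h4 (by omega)
    omega
  · right
    omega

/-- For every odd positive integer `k` and every constant `c > 0` there is a
constant `C(k,c) > 0` such that for every `n`, every positive integer
`f ≤ c·n^{2/(k(k+1))}`, and every weighted graph `G` on `n` vertices, there exists an
`f`-EFT `(2k−1)`-emulator `H` of `G` with `|E(H)| ≤ C(k,c)·n^{1+1/k}`. -/
theorem statement_3 (k : ℕ) (hk : Odd k) (c : ℝ) (hc : 0 < c) :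
    ∃ C : ℝ, 0 < C ∧
      ∀ (V : Type) [Fintype V], ∀ (G : SimpleGraph V) (w : Sym2 V → ℝ≥0∞) (f : ℕ),
        0 < f →
        (f : ℝ) ≤ c * (Fintype.card V : ℝ) ^ ((2 : ℝ) / ((k : ℝ) * ((k : ℝ) + 1))) →
        (∀ e ∈ G.edgeSet, 0 < w e ∧ w e ≠ ⊤) →
        ∃ H : SimpleGraph V,
          IsEFTEmulator G w H f ((2 * k - 1 : ℕ) : ℝ≥0∞) ∧
          (H.edgeSet.ncard : ℝ) ≤ C * (Fintype.card V : ℝ) ^ (1 + 1 / (k : ℝ)) := by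
  obtain ⟨h, rfl⟩ := hk
  set A : ℝ := 4 * ((2 * h + 2) ^ 5 * (h + 1) ^ 4 * 40 ^ (2 * h + 1)) with hA
  set b : ℝ := 8 * (2 * h + 1) ^ 2 * c with hb
  refine ⟨20 * (4 + A * b ^ (h + 1)), by positivity, fun V _ G w f hf hfc _ => ?_⟩
  rcases isEmpty_or_nonempty V with hV | hV
  · refine ⟨G, fun F _ _ u => hV.elim u, ?_⟩
    rw [Set.eq_empty_of_isEmpty G.edgeSet, Set.ncard_empty, Nat.cast_zero]
    positivity
  obtain ⟨H, hH, K, hK⟩ := exists_emulator_blockedGraph G w hf h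
  refine ⟨H, hH, ?_⟩
  obtain ⟨d, hd, hd'⟩ := K.exists_degree_bound
  have hn : 0 < Fintype.card V := Fintype.card_pos
  generalize Fintype.card V = n at *
  have hn0 : (0 : ℝ) < n := by exact_mod_cast hn
  set r : ℝ := (n : ℝ) ^ (1 / ((2 * h + 1 : ℕ) : ℝ)) with hr
  have hr0 : 0 < r := Real.rpow_pos_of_pos hn0 _
  have hdr : (d : ℝ) ≤ (4 + A * b ^ (h + 1)) * r := by
    rcases hd' with hd' | hd'
    · have h1 : (d : ℝ) ≤ 4 * r := by
        refine le_of_pow_le_pow_left₀ (n := 2 * h + 1) (by omega) (by positivity) ?_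
        have h2 : r ^ (2 * h + 1) = n := by
          rw [hr, one_div]
          exact Real.rpow_inv_natCast_pow hn0.le (by omega)
        calc (d : ℝ) ^ (2 * h + 1) ≤ 4 * n := by exact_mod_cast hd'
          _ ≤ 4 ^ (2 * h + 1) * n := by
              gcongr
              exact le_self_pow₀ (by norm_num) (by omega)
          _ = (4 * r) ^ (2 * h + 1) := by rw [mul_pow, h2]
      have : 0 ≤ A * b ^ (h + 1) * r := by positivity
      linarith
    · have hf1 : (1 : ℝ) ≤ f := by exact_mod_cast hf
      have h1 : (f : ℝ) ^ (h + 1) ≤ c ^ (h + 1) * r := by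
        calc (f : ℝ) ^ (h + 1) ≤ (c * (n : ℝ) ^ ((2 : ℝ) /
              (((2 * h + 1 : ℕ) : ℝ) * (((2 * h + 1 : ℕ) : ℝ) + 1)))) ^ (h + 1) := by gcongr
          _ = c ^ (h + 1) * r := by
              rw [mul_pow, hr, ← Real.rpow_mul_natCast hn0.le]
              congr 2
              push_cast
              field_simp
              ring
      have h2 : (d : ℝ) ≤ A * ((2 * h + 1) * (2 * h + 1) * (2 * (3 * f + 1))) ^ (h + 1) := by
        rw [hA]; exact_mod_cast hd'
      calc (d : ℝ) ≤ A * ((2 * h + 1) * (2 * h + 1) * (2 * (3 * f + 1))) ^ (h + 1) := h2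
        _ ≤ A * (8 * (2 * h + 1) ^ 2 * f) ^ (h + 1) := by
            refine mul_le_mul_of_nonneg_left (pow_le_pow_left₀ (by positivity) ?_ _) (by positivity)
            nlinarith [mul_nonneg (sq_nonneg (2 * (h : ℝ) + 1)) (sub_nonneg.2 hf1)]
        _ = A * (8 * (2 * h + 1) ^ 2) ^ (h + 1) * f ^ (h + 1) := by rw [mul_pow _ (f : ℝ), ← mul_assoc A]
        _ ≤ A * (8 * (2 * h + 1) ^ 2) ^ (h + 1) * (c ^ (h + 1) * r) := by gcongr
        _ = A * b ^ (h + 1) * r := by rw [hb, mul_pow _ c]; ring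
        _ ≤ _ := by gcongr; linarith
  calc (H.edgeSet.ncard : ℝ) ≤ 20 * (n * d) := by exact_mod_cast hK.trans hd
    _ ≤ 20 * (n * ((4 + A * b ^ (h + 1)) * r)) := by gcongr
    _ = 20 * (4 + A * b ^ (h + 1)) * (n * r) := by ring
    _ = _ := by rw [Real.rpow_add hn0, Real.rpow_one]
end

section
/- Let r ≥ 1 be an integer, let G be an r-regular graph on n vertices with unit edge weights, let f ≥ 2r − 2, and let t ≥ 1 be a real number. Then every f-EFT t-emulator H of G contains every edge of G, i.e. E(G) ⊆ E(H); in particular |E(H)| ≥ rn/2. Consequently, for every stretch t and fault parameter f there are n-node graphs for which any f-EFT t-emulator has Ω(fn) edges. -/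
open SimpleGraph
open scoped ENNReal

/-- A finite weighted distance is witnessed by a walk. -/
lemma reachable_of_wdist_ne_top {V : Type} {G : SimpleGraph V} {w : Sym2 V → ℝ≥0∞} {u v : V}
    (h : wdist G w u v ≠ ⊤) : G.Reachable u v := by
  by_contra hr
  have : IsEmpty (G.Walk u v) := ⟨fun p => hr ⟨p⟩⟩
  exact h (by simp [wdist])

/-- If the emulator distance from `u` to a different vertex is finite, then `u` has an
`H`-neighbor at finite distance. -/
lemma exists_adj_of_emulDist_ne_top {V : Type} {H : SimpleGraph V} {δ : V → V → ℝ≥0∞} {u v : V}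
    (huv : u ≠ v) (h : emulDist H δ u v ≠ ⊤) : ∃ y, H.Adj u y ∧ δ u y ≠ ⊤ := by
  obtain ⟨p, hp⟩ := iInf_lt_iff.mp (lt_top_iff_ne_top.mpr h)
  cases p with
  | nil => exact absurd rfl huv
  | cons hadj p =>
    refine ⟨_, hadj, fun htop => ?_⟩
    simp [htop] at hp

lemma wdist_one_le_one_of_adj {V : Type} {G : SimpleGraph V} {u v : V} (h : G.Adj u v) :
    wdist G (fun _ => 1) u v ≤ 1 :=
  (iInf_le _ h.toWalk).trans (by simp)

/-- A set closed under adjacency is closed under reachability. -/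
lemma mem_of_reachable_of_adj_closed {V : Type} {G : SimpleGraph V} {S : Set V}
    (hS : ∀ x ∈ S, ∀ y, G.Adj x y → y ∈ S) {u v : V} (hu : u ∈ S) (h : G.Reachable u v) :
    v ∈ S := by
  obtain ⟨p⟩ := h
  induction p with
  | nil => exact hu
  | cons hadj _ ih => exact ih (hS _ hu _ hadj)

/-- If `G` has an edge `uv` such that at most `f` other edges touch `u` or `v`, then any
`f`-EFT emulator of finite stretch contains `uv`. -/
lemma IsEFTEmulator.adj_of_adj {V : Type} {G H : SimpleGraph V} {f : ℕ} {t : ℝ≥0∞}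
    (hH : IsEFTEmulator G (fun _ => 1) H f t) (ht : t ≠ ⊤) {u v : V} (huv : G.Adj u v)
    {F : Finset (Sym2 V)} (hF : (F : Set (Sym2 V)) =
      (G.incidenceSet u ∪ G.incidenceSet v) \ {s(u, v)}) (hcard : F.card ≤ f) :
    H.Adj u v := by
  have hFG : (F : Set (Sym2 V)) ⊆ G.edgeSet := by
    rw [hF]
    rintro e ⟨he | he, -⟩ <;> exact he.1
  set G' := G.deleteEdges (F : Set (Sym2 V)) with hG'
  have hadj : G'.Adj u v := by simp [hG', deleteEdges_adj, hF, huv]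
  have hdist : emulDist H (wdist G' fun _ => 1) u v ≠ ⊤ :=
    ne_top_of_le_ne_top
      (ENNReal.mul_ne_top ht
        (ne_top_of_le_ne_top ENNReal.one_ne_top (wdist_one_le_one_of_adj hadj)))
      (hH F hFG hcard u v).2
  obtain ⟨y, hy, hδ⟩ := exists_adj_of_emulDist_ne_top huv.ne hdist
  have hclosed : ∀ x ∈ ({u, v} : Set V), ∀ y, G'.Adj x y → y ∈ ({u, v} : Set V) := by
    intro x hx y hxy
    rw [hG', deleteEdges_adj, hF] at hxy
    obtain ⟨hxy, hnot⟩ := hxy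
    have he : s(x, y) = s(u, v) := by
      by_contra hne
      refine hnot ⟨?_, hne⟩
      rcases hx with rfl | rfl
      · exact Or.inl ⟨hxy, Sym2.mem_mk_left _ _⟩
      · exact Or.inr ⟨hxy, Sym2.mem_mk_left _ _⟩
    have hmem : y ∈ s(u, v) := he ▸ Sym2.mem_mk_right x y
    simpa using hmem
  rcases mem_of_reachable_of_adj_closed hclosed (Or.inl rfl) (reachable_of_wdist_ne_top hδ)
    with rfl | rfl
  · exact absurd hy (H.irrefl)
  · exact hy

/-- At most `deg u + deg v - 2` edges other than `uv` touch an endpoint of the edge `uv`. -/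
lemma card_incidenceFinset_union_sdiff_le {V : Type} [Fintype V] [DecidableEq V]
    (G : SimpleGraph V) [DecidableRel G.Adj] {u v : V} (h : G.Adj u v) :
    ((G.incidenceFinset u ∪ G.incidenceFinset v) \ {s(u, v)}).card ≤
      (G.degree u - 1) + (G.degree v - 1) := by
  have hu : s(u, v) ∈ G.incidenceFinset u := by
    simpa [mem_incidenceFinset] using (G.mk'_mem_incidenceSet_left_iff).2 h
  have hv : s(u, v) ∈ G.incidenceFinset v := by
    simpa [mem_incidenceFinset] using (G.mk'_mem_incidenceSet_right_iff).2 h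
  rw [Finset.union_sdiff_distrib]
  refine (Finset.card_union_le _ _).trans (le_of_eq ?_)
  rw [Finset.card_sdiff_of_subset (by simpa using hu),
    Finset.card_sdiff_of_subset (by simpa using hv)]
  simp

/-- Let `r ≥ 1`, let `G` be an `r`-regular graph on `n` vertices with unit
edge weights, let `f ≥ 2r − 2`, and let `t ≥ 1` be real. Then every `f`-EFT `t`-emulator
`H` of `G` contains every edge of `G`; in particular `|E(H)| ≥ rn/2`. -/
theorem statement_5 {V : Type} [Fintype V] (r : ℕ) (hr : 1 ≤ r) (G : SimpleGraph V)
    (hreg : ∀ v : V, (G.neighborSet v).ncard = r)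
    (f : ℕ) (hf : 2 * r - 2 ≤ f) (t : ℝ) (ht : 1 ≤ t)
    (H : SimpleGraph V) (hH : IsEFTEmulator G (fun _ => 1) H f (ENNReal.ofReal t)) :
    G.edgeSet ⊆ H.edgeSet ∧
      ((r : ℝ) * (Fintype.card V : ℝ)) / 2 ≤ (H.edgeSet.ncard : ℝ) := by
  classical
  have hdeg : ∀ v, G.degree v = r := fun v => by
    rw [← hreg v, ← card_neighborSet_eq_degree, Set.ncard_eq_toFinset_card', Set.toFinset_card]
  have hsub : G.edgeSet ⊆ H.edgeSet := by
    intro e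
    induction e using Sym2.ind with
    | _ u v =>
      intro (huv : G.Adj u v)
      have hcard := card_incidenceFinset_union_sdiff_le G huv
      rw [hdeg, hdeg] at hcard
      exact hH.adj_of_adj ENNReal.ofReal_ne_top huv
        (F := (G.incidenceFinset u ∪ G.incidenceFinset v) \ {s(u, v)})
        (by simp) (by omega)
  refine ⟨hsub, ?_⟩
  have hsum : Fintype.card V * r = 2 * G.edgeSet.ncard := by
    have := G.sum_degrees_eq_twice_card_edges
    rw [← coe_edgeFinset, Set.ncard_coe_finset, ← this]
    simp [hdeg]
  have hle : (G.edgeSet.ncard : ℝ) ≤ H.edgeSet.ncard := by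
    exact_mod_cast Set.ncard_le_ncard hsub (Set.toFinite _)
  have hsum' : (Fintype.card V : ℝ) * r = 2 * G.edgeSet.ncard := by exact_mod_cast hsum
  linarith
end
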